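/- arXiv:1906.03120 — 2 statements merged into one kernel-verified Lean document; each statement's English description precedes it below -/
import Mathlib

section
/- Let n ≥ 1 and let k1, k2, k3 ≥ 2 be integers with 1/k1 + 1/k2 + 1/k3 < 1, and let Γ = Δ(k1,k2,k3). Let ρ0 : Γ → PGL(2n,ℝ) be a homomorphism sending a, b, c to the classes of reflections Refl(U1⁺,U1⁻), Refl(U2⁺,U2⁻), Refl(U3⁺,U3⁻) in pairs of n-dimensional subspaces of ℝ^{2n}, where the six subspaces U1±, U2±, U3± are pairwise transverse and the cross-ratios are scalar: [U2⁺,U2⁻;U3⁺,U3⁻] = sin²(π/(2k1))·id, [U1⁺,U1⁻;U3⁺,U3⁻] = sin²(π/(2k2))·id, and [U1⁺,U1⁻;U2⁺,U2⁻] = sin²(π/(2k3))·id (these conditions hold for the composition i_{2n}∘ρ_geom of the geometric representation of Γ into PGL(2,ℝ) with the diagonal embedding into PGL(2n,ℝ)). Then ρ0 is locally rigid: for every family (ρ_t)_{t ∈ [0,1]} of homomorphisms Γ → PGL(2n,ℝ) with ρ_0 = ρ0 such that t ↦ ρ_t(γ) is continuous for every γ ∈ Γ, every ρ_t is conjugate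 to ρ0, i.e., for each t ∈ [0,1] there exists h ∈ GL(2n,ℝ) with ρ_t(γ) = [h]·ρ0(γ)·[h]⁻¹ for all γ ∈ Γ. -/
open Module Submodule

variable {V : Type*} [AddCommGroup V] [Module ℝ V]

/-- The projection onto `U` with kernel `W`, as an endomorphism of `V`. -/
noncomputable def projTo (U W : Submodule ℝ V) (h : IsCompl U W) : V →ₗ[ℝ] V :=
  U.subtype ∘ₗ U.linearProjOfIsCompl W h

/-- The reflection in the pair `(U, W)`: `π_U^W - π_W^U`. -/
noncomputable def reflPair (U W : Submodule ℝ V) (h : IsCompl U W) : V →ₗ[ℝ] V :=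
  projTo U W h - projTo W U h.symm

/-- The generalized cross-ratio `[U1,U2;U3,U4]`: the restriction of
`π_{U1}^{U2} ∘ π_{U3}^{U4}` to `U1`, as an endomorphism of `U1`. -/
noncomputable def crossRatio (U1 U2 U3 U4 : Submodule ℝ V)
    (h12 : IsCompl U1 U2) (h34 : IsCompl U3 U4) : U1 →ₗ[ℝ] U1 :=
  (U1.linearProjOfIsCompl U2 h12) ∘ₗ (projTo U3 U4 h34) ∘ₗ U1.subtype

/-- The relators of the triangle group `Δ(k1,k2,k3)` on generators `a = of 0`,
`b = of 1`, `c = of 2`. -/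
def triangleRels (k1 k2 k3 : ℕ) : Set (FreeGroup (Fin 3)) :=
  {(FreeGroup.of 0) ^ 2, (FreeGroup.of 1) ^ 2, (FreeGroup.of 2) ^ 2,
   (FreeGroup.of 0 * FreeGroup.of 1) ^ k1, (FreeGroup.of 1 * FreeGroup.of 2) ^ k2,
   (FreeGroup.of 0 * FreeGroup.of 2) ^ k3}

/-- The triangle group `Δ(k1,k2,k3)`. -/
abbrev TriangleGroup (k1 k2 k3 : ℕ) := PresentedGroup (triangleRels k1 k2 k3)

/-- `PGL(m,ℝ)`: the quotient of `GL(m,ℝ)` by its center, with the quotient topology. -/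
abbrev PGLR (m : ℕ) := GL (Fin m) ℝ ⧸ Subgroup.center (GL (Fin m) ℝ)

section
variable {R : Type*} [Ring R] [Algebra ℝ R]

/-- Three involutions with scalar anticommutators. -/
structure InvolutionTriple (A B C : R) (x y z : ℝ) : Prop where
  sqA : A * A = 1
  sqB : B * B = 1
  sqC : C * C = 1
  ab : A * B + B * A = x • (1 : R)
  bc : B * C + C * B = y • (1 : R)
  ac : A * C + C * A = z • (1 : R)

/-- The antisymmetrized triple product. -/
noncomputable def antisymProd (A B C : R) (x y z : ℝ) : R :=
  A * B * C - (1 / 2 : ℝ) • (y • A - z • B + x • C)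

namespace InvolutionTriple
variable {A B C : R} {x y z : ℝ}

lemma mul_ba (h : InvolutionTriple A B C x y z) : B * A = x • (1 : R) - A * B := by
  rw [← h.ab]; abel

lemma mul_ca (h : InvolutionTriple A B C x y z) : C * A = z • (1 : R) - A * C := by
  rw [← h.ac]; abel

lemma mul_cb (h : InvolutionTriple A B C x y z) : C * B = y • (1 : R) - B * C := by
  rw [← h.bc]; abel

lemma mul_ba_assoc (h : InvolutionTriple A B C x y z) (W : R) :
    B * (A * W) = x • W - A * (B * W) := by
  rw [← mul_assoc, h.mul_ba]; simp [sub_mul, mul_assoc]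

lemma mul_ca_assoc (h : InvolutionTriple A B C x y z) (W : R) :
    C * (A * W) = z • W - A * (C * W) := by
  rw [← mul_assoc, h.mul_ca]; simp [sub_mul, mul_assoc]

lemma mul_cb_assoc (h : InvolutionTriple A B C x y z) (W : R) :
    C * (B * W) = y • W - B * (C * W) := by
  rw [← mul_assoc, h.mul_cb]; simp [sub_mul, mul_assoc]

lemma sqA_assoc (h : InvolutionTriple A B C x y z) (W : R) : A * (A * W) = W := by
  rw [← mul_assoc, h.sqA, one_mul]

lemma sqB_assoc (h : InvolutionTriple A B C x y z) (W : R) : B * (B * W) = W := by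
  rw [← mul_assoc, h.sqB, one_mul]

lemma sqC_assoc (h : InvolutionTriple A B C x y z) (W : R) : C * (C * W) = W := by
  rw [← mul_assoc, h.sqC, one_mul]

set_option linter.unusedSimpArgs false

lemma antisymProd_commute_left (h : InvolutionTriple A B C x y z) :
    antisymProd A B C x y z * A = A * antisymProd A B C x y z := by
  unfold antisymProd
  simp only [mul_add, add_mul, mul_sub, sub_mul, smul_mul_assoc, mul_smul_comm, mul_assoc,
    h.mul_ba, h.mul_ca, h.mul_cb, h.mul_ba_assoc, h.mul_ca_assoc, h.mul_cb_assoc, h.sqA_assoc,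
    h.sqB_assoc, h.sqC_assoc, h.sqA, h.sqB, h.sqC, smul_add, smul_sub, mul_one, one_mul]
  module

lemma antisymProd_commute_middle (h : InvolutionTriple A B C x y z) :
    antisymProd A B C x y z * B = B * antisymProd A B C x y z := by
  unfold antisymProd
  simp only [mul_add, add_mul, mul_sub, sub_mul, smul_mul_assoc, mul_smul_comm, mul_assoc,
    h.mul_ba, h.mul_ca, h.mul_cb, h.mul_ba_assoc, h.mul_ca_assoc, h.mul_cb_assoc, h.sqA_assoc,
    h.sqB_assoc, h.sqC_assoc, h.sqA, h.sqB, h.sqC, smul_add, smul_sub, mul_one, one_mul]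
  module

lemma antisymProd_mul_self (h : InvolutionTriple A B C x y z) :
    antisymProd A B C x y z * antisymProd A B C x y z
      = ((x ^ 2 + y ^ 2 + z ^ 2 - x * y * z) / 4 - 1) • (1 : R) := by
  unfold antisymProd
  simp only [mul_add, add_mul, mul_sub, sub_mul, smul_mul_assoc, mul_smul_comm, mul_assoc,
    h.mul_ba, h.mul_ca, h.mul_cb, h.mul_ba_assoc, h.mul_ca_assoc, h.mul_cb_assoc, h.sqA_assoc,
    h.sqB_assoc, h.sqC_assoc, h.sqA, h.sqB, h.sqC, smul_add, smul_sub, mul_one, one_mul]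
  module

/-- The third involution is determined by the first two and the antisymmetrized product. -/
lemma smul_eq (h : InvolutionTriple A B C x y z) :
    (1 - x ^ 2 / 4) • C = (1 - (x / 2) • (A * B)) *
      (B * A * antisymProd A B C x y z + (1 / 2 : ℝ) • (B * A * (y • A - z • B))) := by
  unfold antisymProd
  simp only [mul_add, add_mul, mul_sub, sub_mul, smul_mul_assoc, mul_smul_comm, mul_assoc,
    h.mul_ba, h.mul_ca, h.mul_cb, h.mul_ba_assoc, h.mul_ca_assoc, h.mul_cb_assoc, h.sqA_assoc,
    h.sqB_assoc, h.sqC_assoc, h.sqA, h.sqB, h.sqC, smul_add, smul_sub, mul_one, one_mul]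
  module

end InvolutionTriple

end

section
open Matrix
variable {ι : Type*} [Fintype ι] [DecidableEq ι]

lemma Matrix.trace_eq_zero_of_anticommute {M N : Matrix ι ι ℝ} {s : ℝ} (hs : s ≠ 0)
    (hN : N * N = s • (1 : Matrix ι ι ℝ)) (hMN : M * N = -(N * M)) : M.trace = 0 := by
  have h1 : (M * N * N).trace = s * M.trace := by
    rw [mul_assoc, hN, mul_smul_comm, mul_one, trace_smul, smul_eq_mul]
  have h2 : (M * N * N).trace = -(s * M.trace) := by
    rw [hMN, neg_mul, trace_neg, trace_mul_comm, ← mul_assoc, hN, smul_mul_assoc, one_mul,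
      trace_smul, smul_eq_mul]
  have : s * M.trace = 0 := by linarith
  exact (mul_eq_zero.mp this).resolve_left hs

/-- Idempotent matrices with the same trace are Murray–von Neumann equivalent. -/
lemma Matrix.exists_mul_eq_of_isIdempotentElem {P Q : Matrix ι ι ℝ} (hP : IsIdempotentElem P)
    (hQ : IsIdempotentElem Q) (h : P.trace = Q.trace) :
    ∃ S T : Matrix ι ι ℝ, T * S = P ∧ S * T = Q ∧ S * P = S ∧ Q * S = S ∧ P * T = T ∧
      T * Q = T := by
  have key (P : Matrix ι ι ℝ) (hP : IsIdempotentElem P) :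
      P.trace = Module.finrank ℝ (LinearMap.range (toLin' P)) := by
    have : IsIdempotentElem (toLin' P) := by
      rw [IsIdempotentElem, Module.End.mul_eq_comp, ← toLin'_mul, hP.eq]
    rw [← (LinearMap.IsIdempotentElem.isProj_range _ this).trace, trace_toLin'_eq]
  have hr : Module.finrank ℝ (LinearMap.range (toLin' P)) =
      Module.finrank ℝ (LinearMap.range (toLin' Q)) := by
    rw [key P hP, key Q hQ] at h
    exact_mod_cast h
  let e := LinearEquiv.ofFinrankEq _ _ hr
  let f := toLin' P
  let g := toLin' Q
  have hf (x) : f (f x) = f x := by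
    simp only [f, ← LinearMap.comp_apply, ← toLin'_mul, hP.eq]
  have hg (x) : g (g x) = g x := by
    simp only [g, ← LinearMap.comp_apply, ← toLin'_mul, hQ.eq]
  have hf' (x : LinearMap.range f) : f.rangeRestrict x = x := by
    obtain ⟨_, y, rfl⟩ := x
    exact Subtype.ext (hf y)
  have hg' (x : LinearMap.range g) : g.rangeRestrict x = x := by
    obtain ⟨_, y, rfl⟩ := x
    exact Subtype.ext (hg y)
  let s : (ι → ℝ) →ₗ[ℝ] (ι → ℝ) := (LinearMap.range g).subtype ∘ₗ e.toLinearMap ∘ₗ f.rangeRestrict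
  let t : (ι → ℝ) →ₗ[ℝ] (ι → ℝ) :=
    (LinearMap.range f).subtype ∘ₗ e.symm.toLinearMap ∘ₗ g.rangeRestrict
  refine ⟨LinearMap.toMatrix' s, LinearMap.toMatrix' t, ?_, ?_, ?_, ?_, ?_, ?_⟩ <;>
    apply toLin'.injective <;> rw [toLin'_mul] <;>
    simp only [toLin'_toMatrix'] <;> refine LinearMap.ext fun x ↦ ?_
  · change ((e.symm (g.rangeRestrict (e (f.rangeRestrict x) : ι → ℝ)) : _) : ι → ℝ) = f x
    rw [hg', e.symm_apply_apply]
    rfl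
  · change ((e (f.rangeRestrict (e.symm (g.rangeRestrict x) : ι → ℝ)) : _) : ι → ℝ) = g x
    rw [hf', e.apply_symm_apply]
    rfl
  · change ((e (f.rangeRestrict (f.rangeRestrict x : ι → ℝ)) : _) : ι → ℝ)
      = (e (f.rangeRestrict x) : _)
    rw [hf']
  · change ((g.rangeRestrict (e (f.rangeRestrict x) : ι → ℝ) : _) : ι → ℝ)
      = (e (f.rangeRestrict x) : _)
    rw [hg']
  · change ((f.rangeRestrict (e.symm (g.rangeRestrict x) : ι → ℝ) : _) : ι → ℝ)
      = (e.symm (g.rangeRestrict x) : _)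
    rw [hf']
  · change ((e.symm (g.rangeRestrict (g.rangeRestrict x : ι → ℝ)) : _) : ι → ℝ)
      = (e.symm (g.rangeRestrict x) : _)
    rw [hg']

/-- Representations of `M₂(ℝ) × M₂(ℝ)`, given by two anticommuting involutions `a`, `b` and a
central involution `w`, are determined up to conjugacy by the trace of `w`. -/
lemma Matrix.exists_conj_of_anticommuting_involutions {a b w a' b' w' : Matrix ι ι ℝ}
    (ha : a * a = 1) (hb : b * b = 1) (hw : w * w = 1) (hab : a * b = -(b * a))
    (hwa : w * a = a * w) (hwb : w * b = b * w)
    (ha' : a' * a' = 1) (hb' : b' * b' = 1) (hw' : w' * w' = 1) (hab' : a' * b' = -(b' * a'))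
    (hwa' : w' * a' = a' * w') (hwb' : w' * b' = b' * w') (htr : w.trace = w'.trace) :
    ∃ H K : Matrix ι ι ℝ, K * H = 1 ∧ H * a = a' * H ∧ H * b = b' * H ∧ H * w = w' * H := by
  have tra {a b : Matrix ι ι ℝ} (hb : b * b = 1) (hab : a * b = -(b * a)) : a.trace = 0 :=
    trace_eq_zero_of_anticommute one_ne_zero (by rw [hb, one_smul]) hab
  have hidem {a w : Matrix ι ι ℝ} (ha : a * a = 1) (hw : w * w = 1) (hwa : w * a = a * w) :
      IsIdempotentElem ((1 / 4 : ℝ) • ((1 + a) * (1 + w))) := by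
    have hwa2 (X : Matrix ι ι ℝ) : w * (a * X) = a * (w * X) := by
      rw [← mul_assoc, hwa, mul_assoc]
    have ha2 (X : Matrix ι ι ℝ) : a * (a * X) = X := by rw [← mul_assoc, ha, one_mul]
    rw [IsIdempotentElem]
    simp only [mul_add, add_mul, smul_mul_assoc, mul_smul_comm, mul_assoc, hwa, hwa2, ha, ha2, hw,
      mul_one, one_mul, smul_add]
    module
  have htrace {a b w : Matrix ι ι ℝ} (hb : b * b = 1) (hab : a * b = -(b * a))
      (hwb : w * b = b * w) :
      ((1 / 4 : ℝ) • ((1 + a) * (1 + w))).trace = (1 / 4 : ℝ) * (Fintype.card ι + w.trace) := by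
    have h1 : (a * w).trace = 0 := by
      refine tra hb ?_
      rw [mul_assoc, hwb, ← mul_assoc, hab, neg_mul, mul_assoc]
    simp [mul_add, add_mul, tra hb hab, h1]
  have exP := exists_mul_eq_of_isIdempotentElem (hidem ha hw hwa) (hidem ha' hw' hwa')
    (by rw [htrace hb hab hwb, htrace hb' hab' hwb', htr])
  have neg_comm {w a : Matrix ι ι ℝ} (h : w * a = a * w) : -w * a = a * -w := by simp [h]
  have neg_sq {w : Matrix ι ι ℝ} (h : w * w = 1) : -w * -w = 1 := by simp [h]
  have exQ := exists_mul_eq_of_isIdempotentElem (hidem ha (neg_sq hw) (neg_comm hwa))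
    (hidem ha' (neg_sq hw') (neg_comm hwa'))
    (by rw [htrace hb hab (neg_comm hwb), htrace hb' hab' (neg_comm hwb'), trace_neg, trace_neg,
      htr])
  obtain ⟨S₁, T₁, hTS₁, hST₁, hSP₁, hQS₁, hPT₁, hTQ₁⟩ := exP
  obtain ⟨S₂, T₂, hTS₂, hST₂, hSP₂, hQS₂, hPT₂, hTQ₂⟩ := exQ
  -- absorption of `a` and `w` by the idempotents
  have aP {a : Matrix ι ι ℝ} (w : Matrix ι ι ℝ) (ha : a * a = 1) :
      a * ((1 / 4 : ℝ) • ((1 + a) * (1 + w))) = (1 / 4 : ℝ) • ((1 + a) * (1 + w)) := by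
    rw [mul_smul_comm, ← mul_assoc, mul_add a 1 a, mul_one, ha, add_comm a 1]
  have Pw {w : Matrix ι ι ℝ} (a : Matrix ι ι ℝ) (hw : w * w = 1) :
      ((1 / 4 : ℝ) • ((1 + a) * (1 + w))) * w = (1 / 4 : ℝ) • ((1 + a) * (1 + w)) := by
    rw [smul_mul_assoc, mul_assoc, add_mul 1 w w, one_mul, hw, add_comm w 1]
  have Pcomm {a w : Matrix ι ι ℝ} (hwa : w * a = a * w) :
      (1 + a) * (1 + w) = (1 + w) * (1 + a) := by
    simp only [mul_add, add_mul, mul_one, one_mul, hwa]; abel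
  have Pa {a w : Matrix ι ι ℝ} (ha : a * a = 1) (hwa : w * a = a * w) :
      ((1 / 4 : ℝ) • ((1 + a) * (1 + w))) * a = (1 / 4 : ℝ) • ((1 + a) * (1 + w)) := by
    rw [Pcomm hwa, smul_mul_assoc, mul_assoc, add_mul 1 a a, one_mul, ha, add_comm a 1]
  have wP {a w : Matrix ι ι ℝ} (hw : w * w = 1) (hwa : w * a = a * w) :
      w * ((1 / 4 : ℝ) • ((1 + a) * (1 + w))) = (1 / 4 : ℝ) • ((1 + a) * (1 + w)) := by
    rw [Pcomm hwa, mul_smul_comm, ← mul_assoc, mul_add w 1 w, mul_one, hw, add_comm w 1]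
  have hS₁a : S₁ * a = S₁ := by rw [← hSP₁, mul_assoc, Pa ha hwa]
  have hS₂a : S₂ * a = S₂ := by rw [← hSP₂, mul_assoc, Pa ha (neg_comm hwa)]
  have haS₁ : a' * S₁ = S₁ := by rw [← hQS₁, ← mul_assoc, aP _ ha']
  have haS₂ : a' * S₂ = S₂ := by rw [← hQS₂, ← mul_assoc, aP _ ha']
  have hT₁a : T₁ * a' = T₁ := by rw [← hTQ₁, mul_assoc, Pa ha' hwa']
  have hT₂a : T₂ * a' = T₂ := by rw [← hTQ₂, mul_assoc, Pa ha' (neg_comm hwa')]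
  have hS₁w : S₁ * w = S₁ := by rw [← hSP₁, mul_assoc, Pw _ hw]
  have hS₂w : S₂ * w = -S₂ := by
    rw [← neg_eq_iff_eq_neg, ← mul_neg, ← hSP₂, mul_assoc, Pw _ (neg_sq hw)]
  have hwS₁ : w' * S₁ = S₁ := by rw [← hQS₁, ← mul_assoc, wP hw' hwa']
  have hwS₂ : w' * S₂ = -S₂ := by
    rw [← neg_eq_iff_eq_neg, ← neg_mul, ← hQS₂, ← mul_assoc, wP (neg_sq hw') (neg_comm hwa')]
  have hT₁w : T₁ * w' = T₁ := by rw [← hTQ₁, mul_assoc, Pw _ hw']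
  have hT₂w : T₂ * w' = -T₂ := by
    rw [← neg_eq_iff_eq_neg, ← mul_neg, ← hTQ₂, mul_assoc, Pw _ (neg_sq hw')]
  have eq_zero_of_neg {X : Matrix ι ι ℝ} (h : X = -X) : X = 0 := by
    ext i j
    have := congrFun (congrFun h i) j
    rw [neg_apply] at this
    rw [zero_apply]
    linarith
  have h12 : T₁ * S₂ = 0 := eq_zero_of_neg (by
    conv_lhs => rw [← hT₁w, mul_assoc, hwS₂, mul_neg])
  have h21 : T₂ * S₁ = 0 := eq_zero_of_neg (by
    conv_lhs => rw [← hwS₁, ← mul_assoc, hT₂w, neg_mul])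
  obtain ⟨S, hS⟩ : ∃ S, S = S₁ + S₂ := ⟨_, rfl⟩
  obtain ⟨T, hT⟩ : ∃ T, T = T₁ + T₂ := ⟨_, rfl⟩
  have hSa : S * a = S := by rw [hS, add_mul, hS₁a, hS₂a]
  have haS : a' * S = S := by rw [hS, mul_add, haS₁, haS₂]
  have hTa : T * a' = T := by rw [hT, add_mul, hT₁a, hT₂a]
  have hSw : S * w = w' * S := by rw [hS, add_mul, mul_add, hS₁w, hS₂w, hwS₁, hwS₂]
  have hTS : T * S = (1 / 2 : ℝ) • (1 + a) := by
    rw [hS, hT, add_mul, mul_add, mul_add, h12, h21, hTS₁, hTS₂]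
    simp only [mul_add, add_mul, mul_neg, mul_one, one_mul]
    module
  have hTbS : T * (b' * S) = 0 := eq_zero_of_neg (by
    conv_lhs => rw [← hTa, ← haS, mul_assoc, ← mul_assoc b', ← mul_assoc a',
      ← mul_assoc a', hab', neg_mul, mul_assoc b', ha', mul_one, neg_mul, mul_neg])
  refine ⟨S + b' * S * b, T + b * T * b', ?_, ?_, ?_, ?_⟩
  · have hb2 (X : Matrix ι ι ℝ) : b' * (b' * X) = X := by rw [← mul_assoc, hb', one_mul]
    have hTbS2 (X : Matrix ι ι ℝ) : T * (b' * (S * X)) = 0 := by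
      rw [← mul_assoc b', ← mul_assoc, hTbS, zero_mul]
    have hTS2 (X : Matrix ι ι ℝ) : T * (S * X) = (1 / 2 : ℝ) • (1 + a) * X := by
      rw [← mul_assoc, hTS]
    simp only [mul_add, add_mul, mul_assoc, hb2, hTbS, hTbS2, hTS2, hTS, smul_mul_assoc,
      mul_smul_comm, one_mul, hb, hab, mul_neg, mul_zero]
    rw [← mul_assoc b b, hb, one_mul]
    module
  · rw [add_mul, mul_add, hSa, haS, mul_assoc _ b a, ← neg_eq_iff_eq_neg.mpr hab,
      mul_neg, ← mul_assoc _ a b, mul_assoc b' S a, hSa, ← mul_assoc, ← mul_assoc a' b', hab',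
      neg_mul, neg_mul, mul_assoc b' a', haS]
  · rw [add_mul, mul_add, mul_assoc _ b b, hb, mul_one, ← mul_assoc, ← mul_assoc b' b', hb',
      one_mul, add_comm]
  · rw [add_mul, mul_add, hSw, mul_assoc _ b w, ← hwb, ← mul_assoc _ w b, mul_assoc b' S w, hSw,
      ← mul_assoc b' w', ← hwb', mul_assoc w', mul_assoc w']

end

section
open Matrix
variable {ι : Type*} [Fintype ι] [DecidableEq ι]

lemma trace_eq_zero_of_anticommutator {A B : Matrix ι ι ℝ} {x : ℝ} (hA : A * A = 1)
    (hB : B * B = 1) (hAB : A * B + B * A = x • (1 : Matrix ι ι ℝ)) (hx : x ^ 2 < 4) :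
    A.trace = 0 := by
  have hBA : B * A = x • (1 : Matrix ι ι ℝ) - A * B := by rw [← hAB]; abel
  refine trace_eq_zero_of_anticommute (N := B - (x / 2) • A) (s := 1 - x ^ 2 / 4) (by linarith)
    ?_ ?_
  · simp only [mul_sub, sub_mul, mul_smul_comm, smul_mul_assoc, hA, hB, hBA, smul_sub]
    module
  · simp only [mul_sub, sub_mul, mul_smul_comm, smul_mul_assoc, hA, hBA]
    module

lemma trace_mul_of_anticommutator {A B : Matrix ι ι ℝ} {x : ℝ}
    (hAB : A * B + B * A = x • (1 : Matrix ι ι ℝ)) :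
    (A * B).trace = x / 2 * Fintype.card ι := by
  have h := congrArg trace hAB
  rw [trace_add, trace_mul_comm B A, trace_smul, trace_one, smul_eq_mul] at h
  linarith

namespace InvolutionTriple
variable {A B C : Matrix ι ι ℝ} {x y z : ℝ}

lemma trace_antisymProd (h : InvolutionTriple A B C x y z) (hx : x ^ 2 < 4) (hz : z ^ 2 < 4) :
    (antisymProd A B C x y z).trace = (A * B * C).trace := by
  have hA : A.trace = 0 := trace_eq_zero_of_anticommutator h.sqA h.sqB h.ab hx
  have hB : B.trace = 0 :=
    trace_eq_zero_of_anticommutator h.sqB h.sqA (by rw [add_comm, h.ab]) hx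
  have hC : C.trace = 0 :=
    trace_eq_zero_of_anticommutator h.sqC h.sqA (by rw [add_comm, h.ac]) hz
  simp [antisymProd, hA, hB, hC]

lemma trace_sq_mul_mul (h : InvolutionTriple A B C x y z) :
    (A * B * C * (A * B * C)).trace
      = ((x ^ 2 + y ^ 2 + z ^ 2 - x * y * z) / 2 - 1) * Fintype.card ι := by
  have key : A * B * C * (A * B * C)
      = z • (A * C) - y • (x • (A * C) - B * C) + (x • (A * B) - 1) := by
    simp only [mul_sub, mul_smul_comm, mul_assoc, h.mul_ba_assoc, h.mul_ca_assoc, h.mul_cb_assoc,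
      h.sqA_assoc, h.sqB_assoc, h.sqA, h.sqB, h.sqC, smul_sub, mul_one]
    module
  rw [key]
  simp only [trace_add, trace_sub, trace_smul, smul_eq_mul, trace_one,
    trace_mul_of_anticommutator h.ab, trace_mul_of_anticommutator h.bc,
    trace_mul_of_anticommutator h.ac]
  ring

/-- Triples of involutions with the same anticommutators (of hyperbolic type) and the same trace
of the triple product are conjugate. -/
lemma exists_conj {A' B' C' : Matrix ι ι ℝ} (h : InvolutionTriple A B C x y z)
    (h' : InvolutionTriple A' B' C' x y z) (hx : x ^ 2 < 4) (hz : z ^ 2 < 4)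
    (hδ : 0 < (x ^ 2 + y ^ 2 + z ^ 2 - x * y * z) / 4 - 1)
    (htr : (A * B * C).trace = (A' * B' * C').trace) :
    ∃ H K : Matrix ι ι ℝ, K * H = 1 ∧ H * A = A' * H ∧ H * B = B' * H ∧ H * C = C' * H := by
  obtain ⟨s, hs, hs2⟩ : ∃ s : ℝ, s ≠ 0 ∧ s * s * (1 - x ^ 2 / 4) = 1 := by
    have h0 : 0 < 1 - x ^ 2 / 4 := by linarith
    refine ⟨(√(1 - x ^ 2 / 4))⁻¹, by positivity, ?_⟩
    rw [← mul_inv, Real.mul_self_sqrt h0.le, inv_mul_cancel₀ h0.ne']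
  obtain ⟨r, hr, hr2⟩ : ∃ r : ℝ, r ≠ 0 ∧
      r * r * ((x ^ 2 + y ^ 2 + z ^ 2 - x * y * z) / 4 - 1) = 1 := by
    refine ⟨(√((x ^ 2 + y ^ 2 + z ^ 2 - x * y * z) / 4 - 1))⁻¹, by positivity, ?_⟩
    rw [← mul_inv, Real.mul_self_sqrt hδ.le, inv_mul_cancel₀ hδ.ne']
  have hb {A B C : Matrix ι ι ℝ} (h : InvolutionTriple A B C x y z) :
      (s • (B - (x / 2) • A)) * (s • (B - (x / 2) • A)) = 1 := by
    have : (B - (x / 2) • A) * (B - (x / 2) • A) = (1 - x ^ 2 / 4) • (1 : Matrix ι ι ℝ) := by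
      simp only [mul_sub, sub_mul, mul_smul_comm, smul_mul_assoc, h.sqA, h.sqB, h.mul_ba, smul_sub]
      module
    rw [smul_mul_smul_comm, this, smul_smul, hs2, one_smul]
  have hab {A B C : Matrix ι ι ℝ} (h : InvolutionTriple A B C x y z) :
      A * (s • (B - (x / 2) • A)) = -((s • (B - (x / 2) • A)) * A) := by
    simp only [mul_sub, sub_mul, mul_smul_comm, smul_mul_assoc, h.sqA, h.mul_ba, smul_sub]
    module
  have hw {A B C : Matrix ι ι ℝ} (h : InvolutionTriple A B C x y z) :
      (r • antisymProd A B C x y z) * (r • antisymProd A B C x y z) = 1 := by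
    rw [smul_mul_smul_comm, h.antisymProd_mul_self, smul_smul, hr2, one_smul]
  have hwa {A B C : Matrix ι ι ℝ} (h : InvolutionTriple A B C x y z) :
      (r • antisymProd A B C x y z) * A = A * (r • antisymProd A B C x y z) := by
    rw [smul_mul_assoc, h.antisymProd_commute_left, mul_smul_comm]
  have hwb {A B C : Matrix ι ι ℝ} (h : InvolutionTriple A B C x y z) :
      (r • antisymProd A B C x y z) * (s • (B - (x / 2) • A))
        = (s • (B - (x / 2) • A)) * (r • antisymProd A B C x y z) := by
    simp only [smul_mul_assoc, mul_smul_comm, mul_sub, sub_mul, h.antisymProd_commute_left,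
      h.antisymProd_commute_middle]
    module
  obtain ⟨H, K, hKH, hA, hB, hW⟩ := exists_conj_of_anticommuting_involutions h.sqA (hb h) (hw h)
    (hab h) (hwa h) (hwb h) h'.sqA (hb h') (hw h') (hab h') (hwa h') (hwb h')
    (by rw [trace_smul, trace_smul, h.trace_antisymProd hx hz, h'.trace_antisymProd hx hz, htr])
  have hB' : H * B = B' * H := by
    rw [mul_smul_comm, smul_mul_assoc] at hB
    have := smul_right_injective _ hs hB
    simp only [mul_sub, sub_mul, mul_smul_comm, smul_mul_assoc, hA] at this
    exact sub_left_injective this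
  have hW' : H * antisymProd A B C x y z = antisymProd A' B' C' x y z * H := by
    rw [mul_smul_comm, smul_mul_assoc] at hW
    exact smul_right_injective _ hr hW
  refine ⟨H, K, hKH, hA, hB', ?_⟩
  have h0 : (1 - x ^ 2 / 4) ≠ 0 := by linarith
  refine smul_right_injective _ h0 ?_
  have hA2 (W) : H * (A * W) = A' * (H * W) := by rw [← mul_assoc, hA, mul_assoc]
  have hB2 (W) : H * (B * W) = B' * (H * W) := by rw [← mul_assoc, hB', mul_assoc]
  change (1 - x ^ 2 / 4) • (H * C) = (1 - x ^ 2 / 4) • (C' * H)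
  rw [← mul_smul_comm, ← smul_mul_assoc, h.smul_eq, h'.smul_eq]
  simp only [mul_add, add_mul, mul_sub, sub_mul, smul_mul_assoc, mul_smul_comm, mul_assoc,
    hA2, hB2, hA, hB', hW', one_mul]

end InvolutionTriple

end

section
open Matrix
variable {ι : Type*} [Fintype ι] [DecidableEq ι]

lemma Matrix.isAlgebraic_trace_of_pow_eq_one {X : Matrix ι ι ℝ} {N : ℕ} (hN : N ≠ 0)
    (h : X ^ N = 1) : IsAlgebraic ℚ X.trace := by
  have hZ : (X.map (algebraMap ℝ ℂ)) ^ N = 1 := by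
    rw [← Matrix.map_pow, h]; simp
  have hroot (r : ℂ) (hr : r ∈ (X.map (algebraMap ℝ ℂ)).charpoly.roots) : IsAlgebraic ℚ r := by
    have hr' := Matrix.mem_spectrum_of_isRoot_charpoly (Polynomial.isRoot_of_mem_roots hr)
    have h1 := spectrum.pow_mem_pow _ N hr'
    rw [hZ] at h1
    have : r ^ N = 1 := by
      by_cases hι : IsEmpty ι
      · have : Subsingleton (Matrix ι ι ℂ) := inferInstance
        simp [spectrum.of_subsingleton] at h1
      · rw [not_isEmpty_iff] at hι
        rw [spectrum.one_eq] at h1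
        exact h1
    refine ⟨Polynomial.X ^ N - 1, ?_, by simp [this]⟩
    exact Polynomial.X_pow_sub_C_ne_zero (Nat.pos_of_ne_zero hN) 1
  have htr : algebraMap ℝ ℂ X.trace = (X.map (algebraMap ℝ ℂ)).charpoly.roots.sum := by
    rw [← Matrix.trace_eq_sum_roots_charpoly]
    exact AddMonoidHom.map_trace (algebraMap ℝ ℂ).toAddMonoidHom X
  rw [← isAlgebraic_algebraMap_iff (algebraMap ℝ ℂ).injective, htr]
  have (s : Multiset ℂ) (hs : ∀ r ∈ s, IsAlgebraic ℚ r) : IsAlgebraic ℚ s.sum := by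
    induction s using Multiset.induction with
    | empty => simpa using isAlgebraic_zero
    | cons a s ih =>
      rw [Multiset.sum_cons]
      exact (hs a (by simp)).add (ih fun r hr ↦ hs r (by simp [hr]))
  exact this _ hroot

open scoped ComplexOrder MatrixOrder in
/-- If `X` has finite order, then `X + X⁻¹` is diagonalizable over the reals, so it is scalar as
soon as its eigenvalues have variance zero. -/
lemma Matrix.add_eq_smul_one_of_pow_eq_one {X Y : Matrix ι ι ℝ} {N : ℕ} (hN : N ≠ 0)
    (hX : X ^ N = 1) (hXY : X * Y = 1) {c : ℝ}
    (htr : ((X + Y - c • 1) * (X + Y - c • 1)).trace = 0) : X + Y = c • 1 := by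
  obtain ⟨P, hP⟩ : ∃ P, P = ∑ j ∈ Finset.range N, (X ^ j)ᴴ * X ^ j := ⟨_, rfl⟩
  have hPX : Xᴴ * P * X = P := by
    have h1 : Xᴴ * P * X = ∑ j ∈ Finset.range N, (X ^ (j + 1))ᴴ * X ^ (j + 1) := by
      rw [hP, Finset.mul_sum, Finset.sum_mul]
      refine Finset.sum_congr rfl fun j _ ↦ ?_
      rw [pow_succ, conjTranspose_mul]
      simp only [mul_assoc]
    have h2 := Finset.sum_range_succ (fun j ↦ (X ^ j)ᴴ * X ^ j) N
    rw [Finset.sum_range_succ', hX, pow_zero, add_left_inj] at h2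
    rw [h1, h2, hP]
  have hpos : P.PosDef := by
    obtain ⟨M, rfl⟩ := Nat.exists_eq_succ_of_ne_zero hN
    rw [hP, Finset.sum_range_succ', pow_zero, conjTranspose_one, one_mul]
    refine Matrix.PosDef.posSemidef_add ?_ Matrix.PosDef.one
    exact posSemidef_sum _ fun j _ ↦ posSemidef_conjTranspose_mul_self _
  obtain ⟨L, hL⟩ : ∃ L : Matrix ι ι ℝ, P = Lᴴ * L :=
    CStarAlgebra.nonneg_iff_eq_star_mul_self.mp hpos.posSemidef.nonneg
  obtain ⟨u, hu⟩ := hpos.isUnit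
  -- a left inverse of `L`
  obtain ⟨R, hR⟩ : ∃ R, R * L = 1 :=
    ⟨(↑u⁻¹ : Matrix ι ι ℝ) * Lᴴ, by rw [mul_assoc, ← hL, ← hu, Units.inv_mul]⟩
  have hR' : L * R = 1 := mul_eq_one_comm.mp hR
  have hYX : Y * X = 1 := mul_eq_one_comm.mp hXY
  obtain ⟨Z, hZ⟩ : ∃ Z, Z = X + Y - c • (1 : Matrix ι ι ℝ) := ⟨_, rfl⟩
  have hXP : Xᴴ * P = P * Y := by
    calc Xᴴ * P = Xᴴ * P * X * Y := by rw [mul_assoc _ X Y, hXY, mul_one]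
      _ = P * Y := by rw [hPX]
  have hYP : Yᴴ * P = P * X := by
    calc Yᴴ * P = Yᴴ * Xᴴ * P * X := by rw [mul_assoc Yᴴ, mul_assoc Yᴴ, hPX]
      _ = P * X := by rw [← conjTranspose_mul, hXY, conjTranspose_one, one_mul]
  have hZP : Zᴴ * P = P * Z := by
    rw [hZ, conjTranspose_sub, conjTranspose_add, conjTranspose_smul, conjTranspose_one, sub_mul,
      add_mul, hXP, hYP, star_trivial, mul_sub, mul_add, smul_mul_assoc, mul_smul_comm, one_mul,
      mul_one, add_comm (P * Y)]
  have hsymm : (L * Z * R)ᴴ = L * Z * R := by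
    calc (L * Z * R)ᴴ = Rᴴ * (Zᴴ * P) * R := by
          rw [hL, conjTranspose_mul, conjTranspose_mul]
          simp only [mul_assoc, hR', mul_one]
      _ = (L * R)ᴴ * L * Z * R := by
          rw [hZP, hL, conjTranspose_mul]; simp only [mul_assoc]
      _ = L * Z * R := by rw [hR', conjTranspose_one, one_mul]
  have h0 : L * Z * R = 0 := by
    rw [← trace_conjTranspose_mul_self_eq_zero_iff, hsymm]
    have : L * Z * R * (L * Z * R) = L * (Z * Z * R) := by
      simp only [mul_assoc]
      rw [← mul_assoc R L, hR, one_mul]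
    rw [this, trace_mul_comm, mul_assoc, hR, mul_one, hZ, htr]
  have : Z = 0 := by
    calc Z = R * L * Z * (R * L) := by rw [hR, one_mul, mul_one]
      _ = R * (L * Z * R) * L := by simp only [mul_assoc]
      _ = 0 := by rw [h0, mul_zero, zero_mul]
  rw [hZ] at this
  exact sub_eq_zero.mp this

end

lemma Continuous.eq_of_countable {X : Type*} [TopologicalSpace X] [PreconnectedSpace X]
    {f : X → ℝ} (hf : Continuous f) {s : Set ℝ} (hs : s.Countable) (hfs : ∀ x, f x ∈ s) (x y : X) :
    f x = f y :=
  hs.isTotallyDisconnected (Set.range f) (Set.range_subset_iff.mpr hfs) (isPreconnected_range hf)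
    ⟨x, rfl⟩ ⟨y, rfl⟩

section

variable {U W : Submodule ℝ V}

lemma projTo_apply_left (h : IsCompl U W) {v : V} (hv : v ∈ U) : projTo U W h v = v := by
  have := Submodule.projectionOnto_apply_left h ⟨v, hv⟩
  exact congrArg Subtype.val this

lemma projTo_apply_right (h : IsCompl U W) {v : V} (hv : v ∈ W) : projTo U W h v = 0 := by
  have := (Submodule.projectionOnto_apply_eq_zero_iff h).mpr hv
  exact congrArg Subtype.val this

lemma projTo_mem (h : IsCompl U W) (v : V) : projTo U W h v ∈ U := Subtype.property _

lemma reflPair_apply (h : IsCompl U W) (v : V) :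
    reflPair U W h v = (2 : ℝ) • projTo U W h v - v := by
  obtain ⟨u, hu, w, hw, rfl⟩ := Submodule.mem_sup.mp (h.sup_eq_top ▸ Submodule.mem_top (x := v))
  simp only [reflPair, LinearMap.sub_apply, map_add, projTo_apply_left h hu,
    projTo_apply_right h hw, projTo_apply_left h.symm hw, projTo_apply_right h.symm hu]
  module

lemma reflPair_mul_self (h : IsCompl U W) : reflPair U W h * reflPair U W h = 1 := by
  ext v
  simp only [Module.End.mul_apply, reflPair_apply h, map_sub, map_smul, Module.End.one_apply,
    projTo_apply_left h (projTo_mem h v)]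
  module

/-- If the cross-ratio of two pairs is a scalar, then the anticommutator of the associated
reflections is a scalar. -/
lemma reflPair_anticommutator {U₁ W₁ U₂ W₂ : Submodule ℝ V} {c : ℝ} (h₁ : IsCompl U₁ W₁)
    (h₂ : IsCompl U₂ W₂) (h : IsCompl U₁ U₂) (h' : IsCompl U₁ W₂)
    (hc : crossRatio U₁ W₁ U₂ W₂ h₁ h₂ = c • LinearMap.id) :
    reflPair U₁ W₁ h₁ * reflPair U₂ W₂ h₂ + reflPair U₂ W₂ h₂ * reflPair U₁ W₁ h₁
      = (4 * c - 2) • (1 : Module.End ℝ V) := by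
  have hPQ {u : V} (hu : u ∈ U₁) : projTo U₁ W₁ h₁ (projTo U₂ W₂ h₂ u) = c • u :=
    congrArg Subtype.val (LinearMap.congr_fun hc ⟨u, hu⟩)
  have hleft {u : V} (hu : u ∈ U₁) :
      (reflPair U₁ W₁ h₁ * reflPair U₂ W₂ h₂ + reflPair U₂ W₂ h₂ * reflPair U₁ W₁ h₁) u
        = ((4 * c - 2) • (1 : Module.End ℝ V)) u := by
    simp only [LinearMap.add_apply, Module.End.mul_apply, reflPair_apply, map_sub, map_smul,
      LinearMap.smul_apply, Module.End.one_apply, hPQ hu, projTo_apply_left h₁ hu]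
    module
  have hright {u : V} (hu : u ∈ U₂) :
      (reflPair U₁ W₁ h₁ * reflPair U₂ W₂ h₂ + reflPair U₂ W₂ h₂ * reflPair U₁ W₁ h₁) u
        = ((4 * c - 2) • (1 : Module.End ℝ V)) u := by
    obtain ⟨v, hv, w, hw, hvw⟩ :=
      Submodule.mem_sup.mp (h'.sup_eq_top ▸ Submodule.mem_top (x := u))
    have huv : u = projTo U₂ W₂ h₂ v := by
      rw [← projTo_apply_left h₂ hu, ← hvw, map_add, projTo_apply_right h₂ hw, add_zero]
    simp only [LinearMap.add_apply, Module.End.mul_apply, reflPair_apply, map_sub, map_smul,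
      LinearMap.smul_apply, Module.End.one_apply, huv, hPQ hv,
      projTo_apply_left h₂ (projTo_mem h₂ v)]
    module
  ext v
  obtain ⟨u, hu, w, hw, rfl⟩ := Submodule.mem_sup.mp (h.sup_eq_top ▸ Submodule.mem_top (x := v))
  rw [map_add, map_add, hleft hu, hright hw]

end

section

lemma cos_sum_pos {α β γ : ℝ} (hα : 0 < α) (hβ : 0 < β) (hγ : 0 < γ) (hα' : α ≤ Real.pi / 2)
    (hβ' : β ≤ Real.pi / 2) (hγ' : γ ≤ Real.pi / 2) (h : α + β + γ < Real.pi) :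
    0 < Real.cos α ^ 2 + Real.cos β ^ 2 + Real.cos γ ^ 2
      + 2 * Real.cos α * Real.cos β * Real.cos γ - 1 := by
  have h1 : 0 < Real.cos γ + Real.cos (α + β) := by
    have := Real.cos_lt_cos_of_nonneg_of_le_pi hγ.le (by linarith) (by linarith :
      γ < Real.pi - (α + β))
    rw [Real.cos_pi_sub] at this
    linarith
  have h2 : 0 < Real.cos γ + Real.cos (α - β) := by
    have h3 : 0 ≤ Real.cos γ := Real.cos_nonneg_of_neg_pi_div_two_le_of_le (by linarith) hγ'
    have h4 : 0 < Real.cos (α - β) := Real.cos_pos_of_mem_Ioo ⟨by linarith, by linarith⟩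
    linarith
  have h5 := mul_pos h1 h2
  rw [Real.cos_add, Real.cos_sub] at h5
  have h6 := Real.sin_sq_add_cos_sq α
  have h7 := Real.sin_sq_add_cos_sq β
  have h8 : Real.sin α ^ 2 * Real.sin β ^ 2 = (1 - Real.cos α ^ 2) * (1 - Real.cos β ^ 2) := by
    rw [eq_sub_of_add_eq h6, eq_sub_of_add_eq h7]
  nlinarith [h8]

lemma four_mul_sin_sq_sub_two (k : ℕ) :
    4 * Real.sin (Real.pi / (2 * k)) ^ 2 - 2 = -2 * Real.cos (Real.pi / k) := by
  have : Real.pi / k = 2 * (Real.pi / (2 * k)) := by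
    rcases eq_or_ne (k : ℝ) 0 with h | h
    · simp [h]
    · field_simp
  rw [this, Real.cos_two_mul, ← Real.sin_sq_add_cos_sq (Real.pi / (2 * k))]
  have := Real.sin_sq_add_cos_sq (Real.pi / (2 * k))
  linarith

lemma four_mul_sin_sq_sub_two_sq_lt {k : ℕ} (hk : 2 ≤ k) :
    (4 * Real.sin (Real.pi / (2 * k)) ^ 2 - 2) ^ 2 < 4 := by
  have hk' : (2 : ℝ) ≤ k := by exact_mod_cast hk
  have hs : 0 < Real.sin (Real.pi / k) :=
    Real.sin_pos_of_pos_of_lt_pi (by positivity) (div_lt_self Real.pi_pos (by linarith))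
  rw [four_mul_sin_sq_sub_two]
  nlinarith [Real.sin_sq_add_cos_sq (Real.pi / k)]

lemma hyperbolic_discriminant_pos {k1 k2 k3 : ℕ} (hk1 : 2 ≤ k1) (hk2 : 2 ≤ k2) (hk3 : 2 ≤ k3)
    (hhyp : (1 : ℝ) / k1 + 1 / k2 + 1 / k3 < 1) {x y z : ℝ}
    (hx : x = 4 * Real.sin (Real.pi / (2 * k3)) ^ 2 - 2)
    (hy : y = 4 * Real.sin (Real.pi / (2 * k1)) ^ 2 - 2)
    (hz : z = 4 * Real.sin (Real.pi / (2 * k2)) ^ 2 - 2) :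
    0 < (x ^ 2 + y ^ 2 + z ^ 2 - x * y * z) / 4 - 1 := by
  have hpos {k : ℕ} (hk : 2 ≤ k) : 0 < Real.pi / k := by
    have : 0 < k := by omega
    positivity
  have hle {k : ℕ} (hk : 2 ≤ k) : Real.pi / k ≤ Real.pi / 2 :=
    div_le_div_of_nonneg_left Real.pi_pos.le two_pos (by exact_mod_cast hk)
  have hsum : Real.pi / k3 + Real.pi / k1 + Real.pi / k2 < Real.pi := by
    have := mul_lt_mul_of_pos_left hhyp Real.pi_pos
    calc Real.pi / k3 + Real.pi / k1 + Real.pi / k2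
        = Real.pi * ((1 : ℝ) / k1 + 1 / k2 + 1 / k3) := by ring
      _ < Real.pi := by linarith
  have := cos_sum_pos (hpos hk3) (hpos hk1) (hpos hk2) (hle hk3) (hle hk1) (hle hk2) hsum
  rw [hx, hy, hz, four_mul_sin_sq_sub_two, four_mul_sin_sq_sub_two, four_mul_sin_sq_sub_two]
  linarith

/-- Sign changes of three vectors realize every sign change of their pairings that preserves the
product. -/
lemma exists_signs {x y z x₀ y₀ z₀ : ℝ} (hx : x = x₀ ∨ x = -x₀) (hy : y = y₀ ∨ y = -y₀)
    (hz : z = z₀ ∨ z = -z₀) (h : x * y * z = x₀ * y₀ * z₀) :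
    ∃ e f g : ℝ, (e = 1 ∨ e = -1) ∧ (f = 1 ∨ f = -1) ∧ (g = 1 ∨ g = -1) ∧
      e * f * x = x₀ ∧ f * g * y = y₀ ∧ e * g * z = z₀ := by
  by_cases h0 : x₀ * y₀ * z₀ = 0
  · simp only [mul_eq_zero, or_assoc] at h0
    rcases h0 with rfl | rfl | rfl <;> rcases hx with rfl | rfl <;> rcases hy with rfl | rfl <;>
    rcases hz with rfl | rfl <;>
    first
    | (refine ⟨1, 1, 1, ?_⟩; simp; done)
    | (refine ⟨1, 1, -1, ?_⟩; simp; done)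
    | (refine ⟨1, -1, 1, ?_⟩; simp; done)
    | (refine ⟨-1, 1, 1, ?_⟩; simp)
  · rcases hx with rfl | rfl <;> rcases hy with rfl | rfl <;> rcases hz with rfl | rfl <;>
    first
    | (refine ⟨1, 1, 1, ?_⟩; simp; done)
    | (refine ⟨1, 1, -1, ?_⟩; simp; done)
    | (refine ⟨1, -1, 1, ?_⟩; simp; done)
    | (refine ⟨-1, 1, 1, ?_⟩; simp; done)
    | exact absurd (by linarith) h0

end

namespace PGLR

variable {m : ℕ}

open Matrix

lemma exists_rep_smul (hm : m ≠ 0) (g : GL (Fin m) ℝ) :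
    ∃ g' : GL (Fin m) ℝ, (g' : Matrix (Fin m) (Fin m) ℝ)
        = (|(g : Matrix (Fin m) (Fin m) ℝ).det| ^ (-(1 / (m : ℝ)))) • (g : Matrix _ _ ℝ) ∧
      |(g' : Matrix (Fin m) (Fin m) ℝ).det| = 1 ∧ (g' : PGLR m) = g := by
  have hd : 0 < |(g : Matrix (Fin m) (Fin m) ℝ).det| :=
    abs_pos.mpr ((Matrix.isUnit_iff_isUnit_det _).mp g.isUnit).ne_zero
  set d := |(g : Matrix (Fin m) (Fin m) ℝ).det|
  have hc : 0 < d ^ (-(1 / (m : ℝ))) := Real.rpow_pos_of_pos hd _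
  have hval : ((GeneralLinearGroup.scalar (Fin m) (Units.mk0 _ hc.ne') * g : GL (Fin m) ℝ) :
      Matrix (Fin m) (Fin m) ℝ) = (d ^ (-(1 / (m : ℝ)))) • (g : Matrix _ _ ℝ) := by
    rw [Units.val_mul]
    ext i j
    simp [Matrix.GeneralLinearGroup.scalar, Matrix.scalar_apply, Matrix.diagonal_mul]
  refine ⟨_, hval, ?_, ?_⟩
  · rw [hval, det_smul, Fintype.card_fin, abs_mul, abs_pow, abs_of_pos hc, ← Real.rpow_natCast,
      ← Real.rpow_mul hd.le]
    have : -(1 / (m : ℝ)) * m = -1 := by field_simp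
    rw [this, Real.rpow_neg_one]
    exact inv_mul_cancel₀ hd.ne'
  · rw [QuotientGroup.mk_mul]
    have : GeneralLinearGroup.scalar (Fin m) (Units.mk0 _ hc.ne') ∈
        Subgroup.center (GL (Fin m) ℝ) := by
      rw [GeneralLinearGroup.center_eq_range_scalar]
      exact ⟨_, rfl⟩
    rw [(QuotientGroup.eq_one_iff _).mpr this, one_mul]

/-- Every class has a representative of determinant `±1`. -/
lemma exists_rep (hm : m ≠ 0) (p : PGLR m) :
    ∃ g : GL (Fin m) ℝ, |(g : Matrix (Fin m) (Fin m) ℝ).det| = 1 ∧ (g : PGLR m) = p := by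
  induction p using QuotientGroup.induction_on with
  | H g =>
    obtain ⟨g₁, -, h⟩ := exists_rep_smul hm g
    exact ⟨g₁, h⟩

/-- Representatives of determinant `±1` are unique up to sign. -/
lemma rep_unique (hm : m ≠ 0) {g g' : GL (Fin m) ℝ}
    (hg : |(g : Matrix (Fin m) (Fin m) ℝ).det| = 1)
    (hg' : |(g' : Matrix (Fin m) (Fin m) ℝ).det| = 1) (h : (g : PGLR m) = g') :
    (g' : Matrix (Fin m) (Fin m) ℝ) = g ∨ (g' : Matrix (Fin m) (Fin m) ℝ) = -g := by
  have h1 := QuotientGroup.eq.mp h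
  rw [GeneralLinearGroup.mem_center_iff_val_mem_range_scalar] at h1
  obtain ⟨c, hc⟩ := h1
  have h2 : (g' : Matrix (Fin m) (Fin m) ℝ) = c • (g : Matrix (Fin m) (Fin m) ℝ) := by
    have : g' = g * (g⁻¹ * g') := by group
    rw [this, Units.val_mul, ← hc]
    ext i j
    simp [Matrix.scalar_apply, Matrix.mul_diagonal, mul_comm]
  have h3 : |c| = 1 := by
    rw [h2, det_smul, abs_mul, hg, mul_one, Fintype.card_fin, abs_pow] at hg'
    exact (pow_eq_one_iff_of_nonneg (abs_nonneg c) hm).mp hg'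
  rcases eq_or_eq_neg_of_abs_eq h3 with rfl | rfl
  · exact Or.inl (by rw [h2, one_smul])
  · exact Or.inr (by rw [h2, neg_one_smul])

/-- Even continuous functions of the normalized representative descend to `PGL`. -/
lemma exists_continuous_descent (hm : m ≠ 0) {w : Matrix (Fin m) (Fin m) ℝ → ℝ}
    (hw : Continuous w) (hneg : ∀ M, w (-M) = w M) :
    ∃ F : PGLR m → ℝ, Continuous F ∧ ∀ g : GL (Fin m) ℝ,
      |(g : Matrix (Fin m) (Fin m) ℝ).det| = 1 → F g = w g := by
  choose rep hrep hmk using exists_rep (m := m) hm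
  have hF (g : GL (Fin m) ℝ) (hg : |(g : Matrix (Fin m) (Fin m) ℝ).det| = 1) :
      w (rep g) = w g := by
    rcases rep_unique hm hg (hrep g) (hmk g).symm with h | h
    · rw [h]
    · rw [h, hneg]
  refine ⟨fun p ↦ w (rep p), ?_, hF⟩
  rw [(QuotientGroup.isQuotientMap_mk (N := Subgroup.center (GL (Fin m) ℝ))).continuous_iff]
  have : ((fun p : PGLR m ↦ w (rep p)) ∘ QuotientGroup.mk) = fun g : GL (Fin m) ℝ ↦
      w ((|(g : Matrix (Fin m) (Fin m) ℝ).det| ^ (-(1 / (m : ℝ)))) • (g : Matrix _ _ ℝ)) := by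
    ext g
    obtain ⟨g', h1, h2, h3⟩ := exists_rep_smul hm g
    rw [Function.comp_apply, ← h1, ← h3]
    exact hF g' h2
  rw [this]
  refine hw.comp (Continuous.smul (Continuous.rpow_const ?_ fun g ↦ Or.inl ?_) Units.continuous_val)
  · exact (Continuous.matrix_det Units.continuous_val).abs
  · exact abs_ne_zero.mpr ((Matrix.isUnit_iff_isUnit_det _).mp g.isUnit).ne_zero

/-- If an even continuous function takes countably many values along a path in `PGL`, it is
constant along that path. -/
lemma eq_of_countable (hm : m ≠ 0) {X : Type*} [TopologicalSpace X] [PreconnectedSpace X]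
    {σ : X → PGLR m} (hσ : Continuous σ) {w : Matrix (Fin m) (Fin m) ℝ → ℝ} (hw : Continuous w)
    (hneg : ∀ M, w (-M) = w M) {s : Set ℝ} (hs : s.Countable)
    (h : ∀ x, ∃ g : GL (Fin m) ℝ,
      |(g : Matrix (Fin m) (Fin m) ℝ).det| = 1 ∧ (g : PGLR m) = σ x ∧ w g ∈ s)
    {x y : X} {g g' : GL (Fin m) ℝ} (hg : |(g : Matrix (Fin m) (Fin m) ℝ).det| = 1)
    (hg' : |(g' : Matrix (Fin m) (Fin m) ℝ).det| = 1) (hgx : (g : PGLR m) = σ x)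
    (hgy : (g' : PGLR m) = σ y) : w g = w g' := by
  obtain ⟨F, hF, hFw⟩ := exists_continuous_descent hm hw hneg
  rw [← hFw g hg, ← hFw g' hg', hgx, hgy]
  refine (hF.comp hσ).eq_of_countable hs (fun x ↦ ?_) x y
  obtain ⟨g, h1, h2, h3⟩ := h x
  rwa [Function.comp_apply, ← h2, hFw g h1]

lemma pow_eq_one_or_neg_one (hm : m ≠ 0) {g : GL (Fin m) ℝ} {k : ℕ}
    (hg : |(g : Matrix (Fin m) (Fin m) ℝ).det| = 1) (h : (g : PGLR m) ^ k = 1) :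
    (g : Matrix (Fin m) (Fin m) ℝ) ^ k = 1 ∨ (g : Matrix (Fin m) (Fin m) ℝ) ^ k = -1 := by
  have := rep_unique hm (g := 1) (g' := g ^ k) (by simp) (by simp [abs_pow, hg])
    (by rw [QuotientGroup.mk_pow, h]; rfl)
  simpa using this

lemma pow_two_mul_eq_one (hm : m ≠ 0) {g : GL (Fin m) ℝ} {k : ℕ}
    (hg : |(g : Matrix (Fin m) (Fin m) ℝ).det| = 1) (h : (g : PGLR m) ^ k = 1) :
    (g : Matrix (Fin m) (Fin m) ℝ) ^ (k * 2) = 1 := by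
  rw [pow_mul]
  rcases pow_eq_one_or_neg_one hm hg h with h | h <;> simp [h]

/-- Trace invariants are constant along paths of elements of bounded order. -/
lemma trace_eq_of_pow_eq_one (hm : m ≠ 0) {X : Type*} [TopologicalSpace X] [PreconnectedSpace X]
    {σ : X → PGLR m} (hσ : Continuous σ) {k : ℕ} (hk : k ≠ 0) (h : ∀ x, σ x ^ k = 1)
    {x y : X} {g g' : GL (Fin m) ℝ} (hg : |(g : Matrix (Fin m) (Fin m) ℝ).det| = 1)
    (hg' : |(g' : Matrix (Fin m) (Fin m) ℝ).det| = 1) (hgx : (g : PGLR m) = σ x)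
    (hgy : (g' : PGLR m) = σ y) :
    (g : Matrix (Fin m) (Fin m) ℝ).trace ^ 2 = (g' : Matrix (Fin m) (Fin m) ℝ).trace ^ 2 ∧
    ((g : Matrix (Fin m) (Fin m) ℝ) * g).trace = ((g' : Matrix (Fin m) (Fin m) ℝ) * g').trace := by
  constructor
  · refine eq_of_countable hm hσ (w := fun M ↦ M.trace ^ 2) (by fun_prop) (by simp)
      (Algebraic.countable ℚ ℝ) (fun x ↦ ?_) hg hg' hgx hgy
    obtain ⟨g, h1, h2⟩ := exists_rep hm (σ x)
    refine ⟨g, h1, h2,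
      IsAlgebraic.pow (isAlgebraic_trace_of_pow_eq_one (N := k * 2) (by omega) ?_) 2⟩
    exact pow_two_mul_eq_one hm h1 (by rw [h2, h])
  · refine eq_of_countable hm hσ (w := fun M ↦ (M * M).trace) (by fun_prop) (by simp)
      (Algebraic.countable ℚ ℝ) (fun x ↦ ?_) hg hg' hgx hgy
    obtain ⟨g, h1, h2⟩ := exists_rep hm (σ x)
    refine ⟨g, h1, h2, isAlgebraic_trace_of_pow_eq_one (N := k * 2) (by omega) ?_⟩
    rw [← pow_two, ← pow_mul, mul_comm 2, pow_mul, pow_two_mul_eq_one hm h1 (by rw [h2, h]),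
      one_pow]

end PGLR

lemma InvolutionTriple.smul {R : Type*} [Ring R] [Algebra ℝ R] {A B C : R} {x y z : ℝ}
    (h : InvolutionTriple A B C x y z) {e f g : ℝ} (he : e * e = 1) (hf : f * f = 1)
    (hg : g * g = 1) :
    InvolutionTriple (e • A) (f • B) (g • C) (e * f * x) (f * g * y) (e * g * z) where
  sqA := by rw [smul_mul_smul_comm, he, h.sqA, one_smul]
  sqB := by rw [smul_mul_smul_comm, hf, h.sqB, one_smul]
  sqC := by rw [smul_mul_smul_comm, hg, h.sqC, one_smul]
  ab := by
    rw [smul_mul_smul_comm, smul_mul_smul_comm, mul_comm f e, ← smul_add, h.ab, smul_smul]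
  bc := by
    rw [smul_mul_smul_comm, smul_mul_smul_comm, mul_comm g f, ← smul_add, h.bc, smul_smul]
  ac := by
    rw [smul_mul_smul_comm, smul_mul_smul_comm, mul_comm g e, ← smul_add, h.ac, smul_smul]

namespace PGLR

variable {m : ℕ}

open Matrix

lemma abs_det_eq_one_of_mul_self {M : Matrix (Fin m) (Fin m) ℝ} (h : M * M = 1) :
    |M.det| = 1 := by
  have h1 := congrArg det h
  rw [det_mul, det_one] at h1
  rcases mul_self_eq_one_iff.mp h1 with h2 | h2 <;> simp [h2]

lemma mk_neg (g : GL (Fin m) ℝ) : ((-g : GL (Fin m) ℝ) : PGLR m) = g := by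
  rw [QuotientGroup.eq, Subgroup.mem_center_iff]
  intro h
  ext1
  simp

lemma exists_rep_sign_smul (g : GL (Fin m) ℝ) {e : ℝ} (he : e = 1 ∨ e = -1) :
    ∃ g' : GL (Fin m) ℝ, (g' : PGLR m) = g ∧
      (g' : Matrix (Fin m) (Fin m) ℝ) = e • (g : Matrix (Fin m) (Fin m) ℝ) := by
  rcases he with rfl | rfl
  · exact ⟨g, rfl, by rw [one_smul]⟩
  · exact ⟨-g, mk_neg g, by rw [neg_one_smul, Units.val_neg]⟩

lemma mk_eq_conj {g g' h : GL (Fin m) ℝ}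
    (H : (h : Matrix (Fin m) (Fin m) ℝ) * g = (g' : Matrix (Fin m) (Fin m) ℝ) * h) :
    (g' : PGLR m) = h * g * (h : PGLR m)⁻¹ := by
  have h1 : h * g = g' * h := Units.ext H
  rw [eq_mul_inv_iff_mul_eq, ← QuotientGroup.mk_mul, ← QuotientGroup.mk_mul, h1]

section Path

variable {X : Type*} [TopologicalSpace X] [PreconnectedSpace X] {σ τ : X → PGLR m} {x₀ x : X}
  {A₀ B₀ A B : GL (Fin m) ℝ}

/-- Along a path of elements of order two starting at the class of an involution, normalized
representatives are involutions. -/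
lemma mul_self_eq_one (hm : m ≠ 0) (hσ : Continuous σ) (hσ2 : ∀ x, σ x ^ 2 = 1)
    (hA₀ : (A₀ : Matrix (Fin m) (Fin m) ℝ) * A₀ = 1) (hA₀σ : (A₀ : PGLR m) = σ x₀)
    (hA : |(A : Matrix (Fin m) (Fin m) ℝ).det| = 1) (hAσ : (A : PGLR m) = σ x) :
    (A : Matrix (Fin m) (Fin m) ℝ) * A = 1 := by
  have h1 := (trace_eq_of_pow_eq_one hm hσ two_ne_zero hσ2 (abs_det_eq_one_of_mul_self hA₀) hA
    hA₀σ hAσ).2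
  have hm' : (m : ℝ) ≠ 0 := Nat.cast_ne_zero.mpr hm
  rcases pow_eq_one_or_neg_one hm hA (k := 2) (by rw [hAσ, hσ2]) with h | h
  · rwa [pow_two] at h
  · rw [pow_two] at h
    rw [h, hA₀, trace_neg, trace_one, Fintype.card_fin] at h1
    exact absurd (by linarith) hm'

/-- Along paths of elements of order two whose product has bounded order, a scalar anticommutator
of involutive representatives is preserved up to sign. -/
lemma anticommutator_eq_or (hm : m ≠ 0) (hστ : Continuous fun x ↦ σ x * τ x) {k : ℕ}
    (hk : k ≠ 0) (hpow : ∀ x, (σ x * τ x) ^ k = 1)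
    (hA₀ : (A₀ : Matrix (Fin m) (Fin m) ℝ) * A₀ = 1) (hA₀σ : (A₀ : PGLR m) = σ x₀)
    (hB₀ : (B₀ : Matrix (Fin m) (Fin m) ℝ) * B₀ = 1) (hB₀τ : (B₀ : PGLR m) = τ x₀)
    (hA : (A : Matrix (Fin m) (Fin m) ℝ) * A = 1) (hAσ : (A : PGLR m) = σ x)
    (hB : (B : Matrix (Fin m) (Fin m) ℝ) * B = 1) (hBτ : (B : PGLR m) = τ x) {c₀ : ℝ}
    (hc : (A₀ : Matrix (Fin m) (Fin m) ℝ) * B₀ + B₀ * A₀ = c₀ • (1 : Matrix (Fin m) (Fin m) ℝ)) :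
    ∃ c, (c = c₀ ∨ c = -c₀) ∧
      (A : Matrix (Fin m) (Fin m) ℝ) * B + B * A = c • (1 : Matrix (Fin m) (Fin m) ℝ) := by
  have hdet : |((A * B : GL (Fin m) ℝ) : Matrix (Fin m) (Fin m) ℝ).det| = 1 := by
    rw [Units.val_mul, det_mul, abs_mul, abs_det_eq_one_of_mul_self hA,
      abs_det_eq_one_of_mul_self hB, one_mul]
  have hdet₀ : |((A₀ * B₀ : GL (Fin m) ℝ) : Matrix (Fin m) (Fin m) ℝ).det| = 1 := by
    rw [Units.val_mul, det_mul, abs_mul, abs_det_eq_one_of_mul_self hA₀,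
      abs_det_eq_one_of_mul_self hB₀, one_mul]
  have hmk : ((A * B : GL (Fin m) ℝ) : PGLR m) = σ x * τ x := by
    rw [QuotientGroup.mk_mul, hAσ, hBτ]
  obtain ⟨h1, h2⟩ := trace_eq_of_pow_eq_one hm hστ hk hpow hdet hdet₀ hmk
    (by rw [QuotientGroup.mk_mul, hA₀σ, hB₀τ])
  have hX := pow_two_mul_eq_one hm hdet (k := k) (by rw [hmk, hpow])
  simp only [Units.val_mul] at h1 h2 hX
  have htr₀ := trace_mul_of_anticommutator hc
  rw [Fintype.card_fin] at htr₀
  generalize (A : Matrix (Fin m) (Fin m) ℝ) = A at *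
  generalize (B : Matrix (Fin m) (Fin m) ℝ) = B at *
  generalize (A₀ : Matrix (Fin m) (Fin m) ℝ) = A₀ at *
  generalize (B₀ : Matrix (Fin m) (Fin m) ℝ) = B₀ at *
  have hsq : A₀ * B₀ * (A₀ * B₀) = c₀ • (A₀ * B₀) - 1 := by
    have hBA : B₀ * A₀ = c₀ • (1 : Matrix (Fin m) (Fin m) ℝ) - A₀ * B₀ := by rw [← hc]; abel
    calc A₀ * B₀ * (A₀ * B₀) = A₀ * (B₀ * A₀) * B₀ := by noncomm_ring
      _ = c₀ • (A₀ * B₀) - (A₀ * A₀) * (B₀ * B₀) := by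
        rw [hBA]; simp [mul_sub, sub_mul, mul_assoc]
      _ = _ := by rw [hA₀, hB₀, one_mul]
  rw [hsq, trace_sub, trace_smul, smul_eq_mul, trace_one, Fintype.card_fin, htr₀] at h2
  rw [htr₀] at h1
  obtain ⟨c, hcc, hct⟩ : ∃ c, (c = c₀ ∨ c = -c₀) ∧ (A * B).trace = c / 2 * m := by
    rcases sq_eq_sq_iff_eq_or_eq_neg.mp h1 with h | h
    · exact ⟨c₀, Or.inl rfl, h⟩
    · exact ⟨-c₀, Or.inr rfl, by rw [h]; ring⟩
  have hcsq : c ^ 2 = c₀ ^ 2 := by rcases hcc with rfl | rfl <;> ring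
  have hAB : A * B * (B * A) = 1 := by
    rw [mul_assoc, ← mul_assoc B, hB, one_mul, hA]
  have hBA : B * A * (A * B) = 1 := by
    rw [mul_assoc, ← mul_assoc A, hA, one_mul, hB]
  refine ⟨c, hcc, add_eq_smul_one_of_pow_eq_one (N := k * 2) (by omega) hX hAB ?_⟩
  have hexp : (A * B + B * A - c • (1 : Matrix (Fin m) (Fin m) ℝ)) *
      (A * B + B * A - c • (1 : Matrix (Fin m) (Fin m) ℝ))
      = A * B * (A * B) + B * A * (B * A) + (2 + c ^ 2) • (1 : Matrix (Fin m) (Fin m) ℝ)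
        - (2 * c) • (A * B) - (2 * c) • (B * A) := by
    simp only [mul_add, add_mul, mul_sub, sub_mul, mul_smul_comm, smul_mul_assoc, hAB, hBA,
      mul_one, one_mul]
    module
  have hcyc : (B * A * (B * A)).trace = (A * B * (A * B)).trace := by
    rw [mul_assoc, trace_mul_comm]; congr 1; noncomm_ring
  rw [hexp, trace_sub, trace_sub, trace_add, trace_add, trace_smul, trace_smul, trace_smul, hcyc,
    trace_mul_comm B A, hct, h2, trace_one, Fintype.card_fin]
  simp only [smul_eq_mul]
  linear_combination (-(m : ℝ)) * hcsq

/-- A path of triples of classes with involutive representatives `A₀, B₀, C₀` at a base point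
satisfying scalar anticommutator relations of positive discriminant stays in a single conjugacy
class, provided that pairwise products have bounded order. -/
lemma exists_conj_of_path (hm : m ≠ 0) {υ : X → PGLR m} {C₀ : GL (Fin m) ℝ}
    (hσ : Continuous σ) (hτ : Continuous τ) (hυ : Continuous υ)
    (hσ2 : ∀ x, σ x ^ 2 = 1) (hτ2 : ∀ x, τ x ^ 2 = 1) (hυ2 : ∀ x, υ x ^ 2 = 1)
    {k l p : ℕ} (hk : k ≠ 0) (hl : l ≠ 0) (hp : p ≠ 0) (hστ : ∀ x, (σ x * τ x) ^ k = 1)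
    (hτυ : ∀ x, (τ x * υ x) ^ l = 1) (hσυ : ∀ x, (σ x * υ x) ^ p = 1)
    (hA₀σ : (A₀ : PGLR m) = σ x₀) (hB₀τ : (B₀ : PGLR m) = τ x₀) (hC₀υ : (C₀ : PGLR m) = υ x₀)
    {a b c : ℝ} (h₀ : InvolutionTriple (A₀ : Matrix (Fin m) (Fin m) ℝ) B₀ C₀ a b c)
    (ha : a ^ 2 < 4) (hc : c ^ 2 < 4) (hδ : 0 < (a ^ 2 + b ^ 2 + c ^ 2 - a * b * c) / 4 - 1)
    (x : X) :
    ∃ h : GL (Fin m) ℝ, σ x = h * σ x₀ * (h : PGLR m)⁻¹ ∧ τ x = h * τ x₀ * (h : PGLR m)⁻¹ ∧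
      υ x = h * υ x₀ * (h : PGLR m)⁻¹ := by
  have hcont : Continuous fun x ↦ σ x * τ x * υ x := (hσ.mul hτ).mul hυ
  have hdet {A B C : GL (Fin m) ℝ} {a b c : ℝ}
      (h : InvolutionTriple (A : Matrix (Fin m) (Fin m) ℝ) B C a b c) :
      |((A * B * C : GL (Fin m) ℝ) : Matrix (Fin m) (Fin m) ℝ).det| = 1 := by
    simp only [Units.val_mul, det_mul, abs_mul, abs_det_eq_one_of_mul_self h.sqA,
      abs_det_eq_one_of_mul_self h.sqB, abs_det_eq_one_of_mul_self h.sqC, one_mul]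
  have hm' : (m : ℝ) ≠ 0 := Nat.cast_ne_zero.mpr hm
  have hreps (x : X) : ∃ (A B C : GL (Fin m) ℝ) (a' b' c' : ℝ), (A : PGLR m) = σ x ∧
      (B : PGLR m) = τ x ∧ (C : PGLR m) = υ x ∧ (a' = a ∨ a' = -a) ∧ (b' = b ∨ b' = -b) ∧
      (c' = c ∨ c' = -c) ∧
      InvolutionTriple (A : Matrix (Fin m) (Fin m) ℝ) B C a' b' c' := by
    obtain ⟨A, hA, hAσ⟩ := exists_rep hm (σ x)
    obtain ⟨B, hB, hBτ⟩ := exists_rep hm (τ x)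
    obtain ⟨C, hC, hCυ⟩ := exists_rep hm (υ x)
    replace hA := mul_self_eq_one hm hσ hσ2 h₀.sqA hA₀σ hA hAσ
    replace hB := mul_self_eq_one hm hτ hτ2 h₀.sqB hB₀τ hB hBτ
    replace hC := mul_self_eq_one hm hυ hυ2 h₀.sqC hC₀υ hC hCυ
    obtain ⟨a', ha', hab⟩ := anticommutator_eq_or hm (hσ.mul hτ) hk hστ h₀.sqA hA₀σ h₀.sqB hB₀τ
      hA hAσ hB hBτ h₀.ab
    obtain ⟨b', hb', hbc⟩ := anticommutator_eq_or hm (hτ.mul hυ) hl hτυ h₀.sqB hB₀τ h₀.sqC hC₀υ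
      hB hBτ hC hCυ h₀.bc
    obtain ⟨c', hc', hac⟩ := anticommutator_eq_or hm (hσ.mul hυ) hp hσυ h₀.sqA hA₀σ h₀.sqC hC₀υ
      hA hAσ hC hCυ h₀.ac
    exact ⟨A, B, C, a', b', c', hAσ, hBτ, hCυ, ha', hb', hc', hA, hB, hC, hab, hbc, hac⟩
  have hreps' (x : X) : ∃ A B C : GL (Fin m) ℝ, (A : PGLR m) = σ x ∧
      (B : PGLR m) = τ x ∧ (C : PGLR m) = υ x ∧
      InvolutionTriple (A : Matrix (Fin m) (Fin m) ℝ) B C a b c := by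
    obtain ⟨A, B, C, a', b', c', hAσ, hBτ, hCυ, ha', hb', hc', h⟩ := hreps x
    have hsq {u v : ℝ} (h : u = v ∨ u = -v) : u ^ 2 = v ^ 2 := by
      rcases h with rfl | rfl <;> ring
    have hprod : a' * b' * c' = a * b * c := by
      have key := eq_of_countable hm hcont (w := fun M ↦ (M * M).trace) (by fun_prop) (by simp)
        (s := {((a ^ 2 + b ^ 2 + c ^ 2 - a * b * c) / 2 - 1) * m,
          ((a ^ 2 + b ^ 2 + c ^ 2 + a * b * c) / 2 - 1) * m}) (Set.to_countable _)
        (fun x ↦ by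
          obtain ⟨A, B, C, a', b', c', hAσ, hBτ, hCυ, ha', hb', hc', h⟩ := hreps x
          refine ⟨A * B * C, hdet h, by simp only [QuotientGroup.mk_mul, hAσ, hBτ, hCυ], ?_⟩
          simp only [Units.val_mul, h.trace_sq_mul_mul, Fintype.card_fin, Set.mem_insert_iff,
            Set.mem_singleton_iff]
          rcases ha' with rfl | rfl <;> rcases hb' with rfl | rfl <;>
          rcases hc' with rfl | rfl <;>
          first
          | (left; ring; done)
          | (right; ring))
        (hdet h) (hdet h₀) (x := x) (y := x₀)
        (by simp only [QuotientGroup.mk_mul, hAσ, hBτ, hCυ])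
        (by simp only [QuotientGroup.mk_mul, hA₀σ, hB₀τ, hC₀υ])
      simp only [Units.val_mul, h.trace_sq_mul_mul, h₀.trace_sq_mul_mul, Fintype.card_fin,
        hsq ha', hsq hb', hsq hc'] at key
      have := mul_right_cancel₀ hm' key
      linarith
    obtain ⟨e, f, g, he, hf, hg, rfl, rfl, rfl⟩ := exists_signs ha' hb' hc' hprod
    have hs {e : ℝ} (he : e = 1 ∨ e = -1) : e * e = 1 := by rcases he with rfl | rfl <;> norm_num
    obtain ⟨A', hA', hA'v⟩ := exists_rep_sign_smul A he
    obtain ⟨B', hB', hB'v⟩ := exists_rep_sign_smul B hf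
    obtain ⟨C', hC', hC'v⟩ := exists_rep_sign_smul C hg
    refine ⟨A', B', C', hA'.trans hAσ, hB'.trans hBτ, hC'.trans hCυ, ?_⟩
    rw [hA'v, hB'v, hC'v]
    exact h.smul (hs he) (hs hf) (hs hg)
  obtain ⟨A, B, C, hAσ, hBτ, hCυ, h, htr⟩ : ∃ A B C : GL (Fin m) ℝ, (A : PGLR m) = σ x ∧
      (B : PGLR m) = τ x ∧ (C : PGLR m) = υ x ∧
      InvolutionTriple (A : Matrix (Fin m) (Fin m) ℝ) B C a b c ∧
      (A₀ * B₀ * C₀ : Matrix (Fin m) (Fin m) ℝ).trace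
        = (A * B * C : Matrix (Fin m) (Fin m) ℝ).trace := by
    obtain ⟨A, B, C, hAσ, hBτ, hCυ, h⟩ := hreps' x
    have key := eq_of_countable hm hcont (w := fun M ↦ M.trace ^ 2) (by fun_prop) (by simp)
      (s := Set.image (fun u : ℝ ↦ ((a ^ 2 + b ^ 2 + c ^ 2 - a * b * c) / 4 - 1) * u ^ 2)
        {u | IsAlgebraic ℚ u}) ((Algebraic.countable ℚ ℝ).image _)
      (fun x ↦ by
        obtain ⟨A, B, C, hAσ, hBτ, hCυ, h⟩ := hreps' x
        refine ⟨A * B * C, hdet h, by simp only [QuotientGroup.mk_mul, hAσ, hBτ, hCυ], ?_⟩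
        obtain ⟨r, hr⟩ : ∃ r : ℝ, r * r * ((a ^ 2 + b ^ 2 + c ^ 2 - a * b * c) / 4 - 1) = 1 := by
          refine ⟨(√((a ^ 2 + b ^ 2 + c ^ 2 - a * b * c) / 4 - 1))⁻¹, ?_⟩
          rw [← mul_inv, Real.mul_self_sqrt hδ.le, inv_mul_cancel₀ hδ.ne']
        refine ⟨_, isAlgebraic_trace_of_pow_eq_one two_ne_zero
          (X := r • antisymProd (A : Matrix (Fin m) (Fin m) ℝ) B C a b c) ?_, ?_⟩
        · rw [pow_two, smul_mul_smul_comm, h.antisymProd_mul_self, smul_smul, hr, one_smul]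
        · simp only [trace_smul, h.trace_antisymProd ha hc, Units.val_mul, smul_eq_mul]
          linear_combination (A * B * C : Matrix (Fin m) (Fin m) ℝ).trace ^ 2 * hr)
      (hdet h₀) (hdet h) (x := x₀) (y := x)
      (by simp only [QuotientGroup.mk_mul, hA₀σ, hB₀τ, hC₀υ])
      (by simp only [QuotientGroup.mk_mul, hAσ, hBτ, hCυ])
    simp only [Units.val_mul] at key
    rcases sq_eq_sq_iff_eq_or_eq_neg.mp key with key | key
    · exact ⟨A, B, C, hAσ, hBτ, hCυ, h, key⟩
    · refine ⟨-A, -B, -C, (mk_neg A).trans hAσ, (mk_neg B).trans hBτ, (mk_neg C).trans hCυ, ?_, ?_⟩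
      · simpa using h.smul (e := -1) (f := -1) (g := -1) (by norm_num) (by norm_num) (by norm_num)
      · simpa using key
  obtain ⟨H, K, hKH, hA, hB, hC⟩ := h₀.exists_conj h ha hc hδ htr
  refine ⟨⟨H, K, mul_eq_one_comm.mp hKH, hKH⟩, ?_, ?_, ?_⟩
  · rw [← hAσ, ← hA₀σ]; exact mk_eq_conj hA
  · rw [← hBτ, ← hB₀τ]; exact mk_eq_conj hB
  · rw [← hCυ, ← hC₀υ]; exact mk_eq_conj hC

end Path

end PGLR

theorem stmt0 (n : ℕ) (hn : 1 ≤ n) (k1 k2 k3 : ℕ)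
    (hk1 : 2 ≤ k1) (hk2 : 2 ≤ k2) (hk3 : 2 ≤ k3)
    (hhyp : (1:ℝ)/k1 + 1/k2 + 1/k3 < 1)
    -- the six subspaces `U i b` (`i` indexing the pairs, `b` the sign)
    (U : Fin 3 → Bool → Submodule ℝ (Fin (2 * n) → ℝ))
    (hdim : ∀ i b, finrank ℝ (U i b) = n)
    (htrans : ∀ i b j b', (i, b) ≠ (j, b') → IsCompl (U i b) (U j b'))
    -- the cross-ratios are the scalars `sin²(π/(2kᵢ))`
    (hcr1 : ∀ (h : IsCompl (U 1 true) (U 1 false)) (h' : IsCompl (U 2 true) (U 2 false)),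
      crossRatio (U 1 true) (U 1 false) (U 2 true) (U 2 false) h h'
        = (Real.sin (Real.pi / (2 * k1)) ^ 2) • LinearMap.id)
    (hcr2 : ∀ (h : IsCompl (U 0 true) (U 0 false)) (h' : IsCompl (U 2 true) (U 2 false)),
      crossRatio (U 0 true) (U 0 false) (U 2 true) (U 2 false) h h'
        = (Real.sin (Real.pi / (2 * k2)) ^ 2) • LinearMap.id)
    (hcr3 : ∀ (h : IsCompl (U 0 true) (U 0 false)) (h' : IsCompl (U 1 true) (U 1 false)),
      crossRatio (U 0 true) (U 0 false) (U 1 true) (U 1 false) h h'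
        = (Real.sin (Real.pi / (2 * k3)) ^ 2) • LinearMap.id)
    -- `ρ0` sends the generators to the classes of the reflections
    (ρ0 : TriangleGroup k1 k2 k3 →* PGLR (2 * n))
    (hρ0 : ∀ (i : Fin 3) (h : IsCompl (U i true) (U i false)),
      ∃ g : GL (Fin (2 * n)) ℝ,
        (g : Matrix (Fin (2 * n)) (Fin (2 * n)) ℝ)
            = LinearMap.toMatrix' (reflPair (U i true) (U i false) h) ∧
        ρ0 (PresentedGroup.of i) = QuotientGroup.mk g)
    -- a continuous family of homomorphisms starting at `ρ0`
    (ρ : Set.Icc (0:ℝ) 1 → (TriangleGroup k1 k2 k3 →* PGLR (2 * n)))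
    (hcont : ∀ γ : TriangleGroup k1 k2 k3, Continuous fun t => ρ t γ)
    (hstart : ρ ⟨0, by norm_num⟩ = ρ0) :
    -- every `ρ t` is conjugate to `ρ0`
    ∀ t, ∃ h : GL (Fin (2 * n)) ℝ, ∀ γ,
      ρ t γ = QuotientGroup.mk h * ρ0 γ * (QuotientGroup.mk h)⁻¹ := by
  classical
  have hm : 2 * n ≠ 0 := by omega
  have hne {i j : Fin 3} {b b' : Bool} (h : i ≠ j ∨ b ≠ b') : IsCompl (U i b) (U j b') :=
    htrans i b j b' fun h' ↦ by simp_all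
  have hU (i : Fin 3) : IsCompl (U i true) (U i false) := hne (by simp)
  choose g hgv hgρ using fun i ↦ hρ0 i (hU i)
  have hsq (i : Fin 3) : (g i : Matrix (Fin (2 * n)) (Fin (2 * n)) ℝ) * g i = 1 := by
    rw [hgv, ← LinearMap.toMatrix'_mul, reflPair_mul_self, LinearMap.toMatrix'_one]
  have hanti {i j : Fin 3} (hij : i ≠ j) {s : ℝ}
      (hs : crossRatio (U i true) (U i false) (U j true) (U j false) (hU i) (hU j)
        = s • LinearMap.id) :
      (g i : Matrix (Fin (2 * n)) (Fin (2 * n)) ℝ) * g j + g j * g i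
        = (4 * s - 2) • (1 : Matrix (Fin (2 * n)) (Fin (2 * n)) ℝ) := by
    have := congrArg LinearMap.toMatrix' (reflPair_anticommutator (hU i) (hU j)
      (hne (Or.inl hij)) (hne (Or.inl hij)) hs)
    rwa [map_add, LinearMap.toMatrix'_mul, LinearMap.toMatrix'_mul, map_smul,
      LinearMap.toMatrix'_one, ← hgv, ← hgv] at this
  have htriple : InvolutionTriple (g 0 : Matrix (Fin (2 * n)) (Fin (2 * n)) ℝ) (g 1) (g 2) _ _ _ :=
    ⟨hsq 0, hsq 1, hsq 2, hanti (by decide) (hcr3 _ _), hanti (by decide) (hcr1 _ _),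
      hanti (by decide) (hcr2 _ _)⟩
  have hrel (t : Set.Icc (0 : ℝ) 1) {r : FreeGroup (Fin 3)} (hr : r ∈ triangleRels k1 k2 k3) :
      ρ t (PresentedGroup.mk (triangleRels k1 k2 k3) r) = 1 := by
    rw [PresentedGroup.one_of_mem hr, map_one]
  have hgen (t : Set.Icc (0 : ℝ) 1) (i : Fin 3) (hr : FreeGroup.of i ^ 2 ∈ triangleRels k1 k2 k3) :
      ρ t (PresentedGroup.of i) ^ 2 = 1 := by
    have := hrel t hr
    rwa [map_pow, map_pow] at this
  have hpair (t : Set.Icc (0 : ℝ) 1) (i j : Fin 3) (k : ℕ)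
      (hr : (FreeGroup.of i * FreeGroup.of j) ^ k ∈ triangleRels k1 k2 k3) :
      (ρ t (PresentedGroup.of i) * ρ t (PresentedGroup.of j)) ^ k = 1 := by
    have := hrel t hr
    rwa [map_pow, map_pow, map_mul, map_mul] at this
  have hg (i : Fin 3) : (g i : PGLR (2 * n)) = ρ ⟨0, by norm_num⟩ (PresentedGroup.of i) := by
    rw [hstart, hgρ]
  intro t
  obtain ⟨h, h0, h1, h2⟩ := PGLR.exists_conj_of_path hm (hcont (PresentedGroup.of 0))
    (hcont (PresentedGroup.of 1)) (hcont (PresentedGroup.of 2))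
    (fun t ↦ hgen t 0 (by simp [triangleRels])) (fun t ↦ hgen t 1 (by simp [triangleRels]))
    (fun t ↦ hgen t 2 (by simp [triangleRels])) (k := k1) (l := k2) (p := k3)
    (by omega) (by omega) (by omega)
    (fun t ↦ hpair t 0 1 k1 (by simp [triangleRels]))
    (fun t ↦ hpair t 1 2 k2 (by simp [triangleRels]))
    (fun t ↦ hpair t 0 2 k3 (by simp [triangleRels])) (hg 0) (hg 1) (hg 2) htriple
    (four_mul_sin_sq_sub_two_sq_lt hk3) (four_mul_sin_sq_sub_two_sq_lt hk2)
    (hyperbolic_discriminant_pos hk1 hk2 hk3 hhyp rfl rfl rfl) t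
  rw [hstart] at h0 h1 h2
  refine ⟨h, fun γ ↦ ?_⟩
  have : ρ t = (MulAut.conj (h : PGLR (2 * n))).toMonoidHom.comp ρ0 := by
    refine PresentedGroup.ext fun i ↦ ?_
    fin_cases i
    · exact h0
    · exact h1
    · exact h2
  rw [this]
  rfl
end

section
/- Let λ1, λ2, λ3 ∈ ℝ be such that the quadratic polynomial λ3(1 − λ2)x² + (λ1 + λ2 − λ3 − 1)x + (1 − λ1) has two distinct real roots (in particular λ3(1 − λ2) ≠ 0). Then the set of 6-tuples (U1⁺, U1⁻, U2⁺, U2⁻, U3⁺, U3⁻) of pairwise transverse n-dimensional subspaces of ℝ^{2n} satisfying [U2⁺,U2⁻;U3⁺,U3⁻] = λ1·id, [U1⁺,U1⁻;U3⁺,U3⁻] = λ2·id, and [U1⁺,U1⁻;U2⁺,U2⁻] = λ3·id decomposes into finitely many orbits under the diagonal action of GL(2n,ℝ): there is a finite set F of such 6-tuples so that every such 6-tuple is obtained from a member of F by applying some g ∈ GL(2n,ℝ) to all six subspaces. -/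
open Module Submodule

variable {V : Type*} [AddCommGroup V] [Module ℝ V]

/-- The condition that a 6-tuple `(U i b)` (`i ∈ {1,2,3}` indexing the pairs, `b` the sign)
of `n`-dimensional subspaces of `ℝ^{2n}` is pairwise transverse with the three scalar
cross-ratios `[U2⁺,U2⁻;U3⁺,U3⁻] = λ1·id`, `[U1⁺,U1⁻;U3⁺,U3⁻] = λ2·id`,
`[U1⁺,U1⁻;U2⁺,U2⁻] = λ3·id`. -/
def GoodTuple (n : ℕ) (l1 l2 l3 : ℝ)
    (U : Fin 3 → Bool → Submodule ℝ (Fin (2 * n) → ℝ)) : Prop :=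
  (∀ i b, Module.finrank ℝ (U i b) = n) ∧
  (∀ i b j b', (i, b) ≠ (j, b') → IsCompl (U i b) (U j b')) ∧
  (∀ (h : IsCompl (U 1 true) (U 1 false)) (h' : IsCompl (U 2 true) (U 2 false)),
    crossRatio (U 1 true) (U 1 false) (U 2 true) (U 2 false) h h' = l1 • LinearMap.id) ∧
  (∀ (h : IsCompl (U 0 true) (U 0 false)) (h' : IsCompl (U 2 true) (U 2 false)),
    crossRatio (U 0 true) (U 0 false) (U 2 true) (U 2 false) h h' = l2 • LinearMap.id) ∧
  (∀ (h : IsCompl (U 0 true) (U 0 false)) (h' : IsCompl (U 1 true) (U 1 false)),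
    crossRatio (U 0 true) (U 0 false) (U 1 true) (U 1 false) h h' = l3 • LinearMap.id)

section ModelTuples

variable {E : Type*} [AddCommGroup E] [Module ℝ E]

/-- The 6-tuple of subspaces of `E × E` consisting of the two factors, the diagonal and the graphs
of `α`, `B` and `d B`. -/
def modelTuple (α d : ℝ) (B : E →ₗ[ℝ] E) : Fin 3 → Bool → Submodule ℝ (E × E)
  | 0, true => Submodule.prod ⊤ ⊥
  | 0, false => Submodule.prod ⊥ ⊤
  | 1, true => LinearMap.graph LinearMap.id
  | 1, false => LinearMap.graph (α • LinearMap.id)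
  | 2, true => LinearMap.graph B
  | 2, false => LinearMap.graph (d • B)

lemma mem_modelTuple_conj (α d : ℝ) {B B' : E →ₗ[ℝ] E} (f : E ≃ₗ[ℝ] E)
    (hf : ∀ w, f (B w) = B' (f w)) (i : Fin 3) (b : Bool) (z : E × E) :
    (f.prodCongr f) z ∈ modelTuple α d B' i b ↔ z ∈ modelTuple α d B i b := by
  have h (c : ℝ) (u w : E) : f u = c • f w ↔ u = c • w := by
    rw [← map_smul, f.injective.eq_iff]
  fin_cases i <;> cases b <;>
    simp [modelTuple, Submodule.mem_prod, LinearMap.mem_graph_iff, ← hf, h]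

lemma isCompl_ker_sub_smul {B : E →ₗ[ℝ] E} {r s : ℝ} (hrs : r ≠ s)
    (hB : ∀ w, B (B w) = (r + s) • B w - (r * s) • w) :
    IsCompl (LinearMap.ker (B - r • LinearMap.id)) (LinearMap.ker (B - s • LinearMap.id)) := by
  have hrs' : r - s ≠ 0 := sub_ne_zero.mpr hrs
  constructor
  · rw [Submodule.disjoint_def]
    intro w hr hs
    simp only [LinearMap.mem_ker, LinearMap.sub_apply, LinearMap.smul_apply,
      LinearMap.id_apply, sub_eq_zero] at hr hs
    have : (r - s) • w = 0 := by rw [sub_smul, ← hr, ← hs, sub_self]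
    exact (smul_eq_zero.mp this).resolve_left hrs'
  · rw [codisjoint_iff, eq_top_iff]
    intro w _
    rw [Submodule.mem_sup]
    refine ⟨(r - s)⁻¹ • (B w - s • w), ?_, (r - s)⁻¹ • (r • w - B w), ?_, ?_⟩
    · simp only [LinearMap.mem_ker, LinearMap.sub_apply, LinearMap.smul_apply, map_smul, map_sub,
        LinearMap.id_apply, hB]
      module
    · simp only [LinearMap.mem_ker, LinearMap.sub_apply, LinearMap.smul_apply, map_smul, map_sub,
        LinearMap.id_apply, hB]
      module
    · rw [← smul_add, inv_smul_eq_iff₀ hrs']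
      module

/-- Endomorphisms annihilated by `(X - r) (X - s)`, with `r ≠ s`, are conjugate as soon as their
`r`-eigenspaces have the same dimension. -/
lemma exists_conj_of_finrank_ker_eq [FiniteDimensional ℝ E] {B B' : E →ₗ[ℝ] E} {r s : ℝ}
    (hrs : r ≠ s)
    (hB : ∀ w, B (B w) = (r + s) • B w - (r * s) • w)
    (hB' : ∀ w, B' (B' w) = (r + s) • B' w - (r * s) • w)
    (hk : finrank ℝ (LinearMap.ker (B - r • LinearMap.id)) =
      finrank ℝ (LinearMap.ker (B' - r • LinearMap.id))) :
    ∃ f : E ≃ₗ[ℝ] E, ∀ w, f (B w) = B' (f w) := by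
  have hc := isCompl_ker_sub_smul hrs hB
  have hc' := isCompl_ker_sub_smul hrs hB'
  have h1 := Submodule.finrank_add_eq_of_isCompl hc
  have h2 := Submodule.finrank_add_eq_of_isCompl hc'
  have hk' : finrank ℝ (LinearMap.ker (B - s • LinearMap.id)) =
      finrank ℝ (LinearMap.ker (B' - s • LinearMap.id)) := by omega
  let P := Submodule.prodEquivOfIsCompl _ _ hc
  let P' := Submodule.prodEquivOfIsCompl _ _ hc'
  let φ := LinearEquiv.ofFinrankEq _ _ hk
  let ψ := LinearEquiv.ofFinrankEq _ _ hk'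
  have key (C : E →ₗ[ℝ] E) (t : ℝ) (u : LinearMap.ker (C - t • LinearMap.id)) :
      C u = t • (u : E) := by
    have := u.2
    simpa only [LinearMap.mem_ker, LinearMap.sub_apply, LinearMap.smul_apply,
      LinearMap.id_apply, sub_eq_zero] using this
  refine ⟨P.symm.trans ((φ.prodCongr ψ).trans P'), fun w => ?_⟩
  obtain ⟨⟨u, v⟩, rfl⟩ := P.surjective w
  have hBP : B (P (u, v)) = P (r • u, s • v) := by
    simp [P, key]
  rw [hBP]
  simp [P', key]

lemma exists_eq_graph_of_isCompl {G : Submodule ℝ (E × E)}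
    (h : IsCompl G (Submodule.prod ⊥ ⊤)) : ∃ f : E →ₗ[ℝ] E, G = LinearMap.graph f := by
  apply Submodule.exists_eq_graph
  constructor
  · rw [← LinearMap.coe_fst (R := ℝ), ← LinearMap.coe_comp, ← LinearMap.ker_eq_bot,
      LinearMap.ker_eq_bot']
    intro m hm
    have := Submodule.disjoint_def.mp h.disjoint m m.2
      (by simpa [Submodule.mem_prod] using hm)
    exact_mod_cast this
  · intro w
    have : ((w, 0) : E × E) ∈ G ⊔ Submodule.prod ⊥ ⊤ := by rw [h.sup_eq_top]; trivial
    obtain ⟨g, hg, q, hq, hgq⟩ := Submodule.mem_sup.mp this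
    refine ⟨⟨g, hg⟩, ?_⟩
    have h1 := congrArg Prod.fst hgq
    have h2 : q.1 = 0 := by simpa [Submodule.mem_prod] using hq.1
    simpa [h2] using h1

lemma surjective_of_isCompl_graph {f : E →ₗ[ℝ] E}
    (h : IsCompl (LinearMap.graph f) (Submodule.prod ⊤ ⊥)) : Function.Surjective f := by
  intro w
  have : ((0, w) : E × E) ∈ LinearMap.graph f ⊔ Submodule.prod ⊤ ⊥ := by
    rw [h.sup_eq_top]; trivial
  obtain ⟨g, hg, q, hq, hgq⟩ := Submodule.mem_sup.mp this
  refine ⟨g.1, ?_⟩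
  have h1 := congrArg Prod.snd hgq
  have h2 : q.2 = 0 := by simpa [Submodule.mem_prod] using hq.2
  rw [LinearMap.mem_graph_iff] at hg
  simpa [h2, hg] using h1

/-- Three pairwise transverse half-dimensional subspaces can be moved to the two factors and the
diagonal. -/
lemma exists_equiv_prod_of_isCompl [FiniteDimensional ℝ E] [FiniteDimensional ℝ V]
    {p q S : Submodule ℝ V} (hpq : IsCompl p q) (hSp : IsCompl S p) (hSq : IsCompl S q)
    (hV : finrank ℝ V = 2 * finrank ℝ E) (hS : finrank ℝ S = finrank ℝ E) :
    ∃ e : (E × E) ≃ₗ[ℝ] V, (∀ z, e z ∈ p ↔ z.2 = 0) ∧ (∀ z, e z ∈ q ↔ z.1 = 0) ∧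
      ∀ z, e z ∈ S ↔ z.1 = z.2 := by
  let j : E ≃ₗ[ℝ] S := LinearEquiv.ofFinrankEq _ _ hS.symm
  let P : E →ₗ[ℝ] V := p.projection q hpq ∘ₗ S.subtype ∘ₗ j.toLinearMap
  let Q : E →ₗ[ℝ] V := q.projection p hpq.symm ∘ₗ S.subtype ∘ₗ j.toLinearMap
  have hPp (x : E) : P x ∈ p := Submodule.projection_apply_mem _ _
  have hQq (x : E) : Q x ∈ q := Submodule.projection_apply_mem _ _
  have hj0 (x : E) (h : (j x : V) = 0) : x = 0 := by simpa using h
  have hP0 (x : E) (h : P x = 0) : x = 0 := by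
    refine hj0 x (Submodule.disjoint_def.mp hSq.disjoint _ (j x).2 ?_)
    exact (Submodule.projection_apply_eq_zero_iff hpq).mp h
  have hQ0 (x : E) (h : Q x = 0) : x = 0 := by
    refine hj0 x (Submodule.disjoint_def.mp hSp.disjoint _ (j x).2 ?_)
    exact (Submodule.projection_apply_eq_zero_iff hpq.symm).mp h
  have hPQ (x : E) : P x + Q x = j x := Submodule.projection_add_projection_eq_self hpq _
  have hq (z : E × E) (h : P z.1 + Q z.2 ∈ q) : z.1 = 0 :=
    hP0 _ (Submodule.disjoint_def.mp hpq.disjoint _ (hPp _)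
      ((Submodule.add_mem_iff_left _ (hQq _)).mp h))
  have hp (z : E × E) (h : P z.1 + Q z.2 ∈ p) : z.2 = 0 :=
    hQ0 _ (Submodule.disjoint_def.mp hpq.symm.disjoint _ (hQq _)
      ((Submodule.add_mem_iff_right _ (hPp _)).mp h))
  have hinj : Function.Injective (P.coprod Q) := by
    rw [← LinearMap.ker_eq_bot, LinearMap.ker_eq_bot']
    intro z hz
    rw [LinearMap.coprod_apply] at hz
    exact Prod.ext (hq z (hz ▸ q.zero_mem)) (hp z (hz ▸ p.zero_mem))
  have hdim : finrank ℝ (E × E) = finrank ℝ V := by rw [Module.finrank_prod]; omega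
  refine ⟨LinearEquiv.ofInjectiveOfFinrankEq (P.coprod Q) hinj hdim, fun z => ⟨hp z, fun h => ?_⟩,
    fun z => ⟨hq z, fun h => ?_⟩, fun z => ⟨fun h => ?_, fun h => ?_⟩⟩
  · change P z.1 + Q z.2 ∈ p
    simpa [h] using hPp z.1
  · change P z.1 + Q z.2 ∈ q
    simpa [h] using hQq z.2
  · have h' : P z.1 + Q z.2 ∈ S := h
    have : P z.1 + Q z.2 = j z.2 + P (z.1 - z.2) := by rw [← hPQ, map_sub]; abel
    rw [this, Submodule.add_mem_iff_right _ (j z.2).2] at h'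
    exact sub_eq_zero.mp (hP0 _ (Submodule.disjoint_def.mp hSp.symm.disjoint _ (hPp _) h'))
  · change P z.1 + Q z.2 ∈ S
    rw [h, hPQ]
    exact (j z.2).2

end ModelTuples

lemma sub_smul_mem_of_crossRatio_eq {U1 U2 U3 U4 : Submodule ℝ V} {h12 : IsCompl U1 U2}
    {h34 : IsCompl U3 U4} {l : ℝ} (h : crossRatio U1 U2 U3 U4 h12 h34 = l • LinearMap.id)
    {a b : V} (ha : a ∈ U3) (hb : b ∈ U4) (hab : a + b ∈ U1) : a - l • (a + b) ∈ U2 := by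
  have h' : U1.projectionOnto U2 h12 (U3.projection U4 h34 (a + b)) = l • ⟨a + b, hab⟩ :=
    LinearMap.congr_fun h ⟨a + b, hab⟩
  rw [map_add, Submodule.projection_apply_of_mem_left h34 ha,
    Submodule.projection_apply_of_mem_right h34 hb, add_zero] at h'
  rw [← Submodule.projectionOnto_apply_eq_zero_iff h12, map_sub, map_smul, h',
    Submodule.projectionOnto_apply_of_mem_left h12 hab, sub_self]

/-- `r` and `s` are the roots of the quadratic equation satisfied by the parameter of the model
tuple associated with a good tuple. -/
lemma exists_roots_of_disc {l1 l2 l3 : ℝ}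
    (hlead : l3 * (1 - l2) ≠ 0) (hl2 : l2 ≠ 0) (hl3 : l3 - 1 ≠ 0) {x y : ℝ} (hxy : x ≠ y)
    (hx : l3 * (1 - l2) * x ^ 2 + (l1 + l2 - l3 - 1) * x + (1 - l1) = 0)
    (hy : l3 * (1 - l2) * y ^ 2 + (l1 + l2 - l3 - 1) * y + (1 - l1) = 0) :
    ∃ r s : ℝ, r ≠ s ∧
      l2 * (l3 - 1) * (r + s) = (l3 - 1) * (l2 - 1) + l2 * l3 - l1 ∧
      l2 * (l3 - 1) * (r * s) = l3 * (l2 - 1) := by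
  set a := l3 * (1 - l2) with ha
  have hsum : a * (x + y) = -(l1 + l2 - l3 - 1) := by
    apply mul_left_cancel₀ (sub_ne_zero.mpr hxy)
    linear_combination hx - hy
  have hprod : a * (x * y) = 1 - l1 := by linear_combination x * hsum - hx
  have hdisc : (a * (x - y)) ^ 2 = (l1 + l2 - l3 - 1) ^ 2 - 4 * a * (1 - l1) := by
    linear_combination (a * (x + y) - (l1 + l2 - l3 - 1)) * hsum - 4 * a * hprod
  have hp : l2 * (l3 - 1) ≠ 0 := mul_ne_zero hl2 hl3
  set δ := a * (x - y)
  have hδ : δ ≠ 0 := mul_ne_zero hlead (sub_ne_zero.mpr hxy)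
  set m := (l3 - 1) * (l2 - 1) + l2 * l3 - l1 with hm
  refine ⟨(m + δ) / (2 * (l2 * (l3 - 1))), (m - δ) / (2 * (l2 * (l3 - 1))), fun h => hδ ?_, ?_, ?_⟩
  · rw [div_left_inj' (by simpa using hp)] at h
    linarith
  · field_simp
    ring
  · have h4 : m ^ 2 - δ ^ 2 = 4 * (l2 * (l3 - 1)) * (l3 * (l2 - 1)) := by
      rw [hdisc, hm, ha]; ring
    field_simp
    linear_combination h4

section Normalization

variable {n : ℕ} {l1 l2 l3 : ℝ}

lemma GoodTuple.exists_modelTuple (hn : n ≠ 0) (hl2 : l2 - 1 ≠ 0)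
    {U : Fin 3 → Bool → Submodule ℝ (Fin (2 * n) → ℝ)} (hU : GoodTuple n l1 l2 l3 U) :
    l2 ≠ 0 ∧ l3 - 1 ≠ 0 ∧
    ∃ (e : ((Fin n → ℝ) × (Fin n → ℝ)) ≃ₗ[ℝ] (Fin (2 * n) → ℝ))
      (B : (Fin n → ℝ) →ₗ[ℝ] (Fin n → ℝ)),
      (∀ i b z, e z ∈ U i b ↔ z ∈ modelTuple (l3 / (l3 - 1)) (l2 / (l2 - 1)) B i b) ∧
      ∀ w, (l2 * (l3 - 1)) • B (B w) =
        ((l3 - 1) * (l2 - 1) + l2 * l3 - l1) • B w - (l3 * (l2 - 1)) • w := by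
  obtain ⟨hdim, hcompl, h1, h2, h3⟩ := hU
  have : NeZero n := ⟨hn⟩
  obtain ⟨e, hep, heq, heS⟩ := exists_equiv_prod_of_isCompl (E := Fin n → ℝ)
    (hcompl 0 true 0 false (by simp)) (hcompl 1 true 0 true (by simp))
    (hcompl 1 true 0 false (by simp)) (by simp) (by simp [hdim])
  have hgraph (i : Fin 3) (b : Bool) (hib : (i, b) ≠ (0, false)) :
      ∃ f : (Fin n → ℝ) →ₗ[ℝ] (Fin n → ℝ), ∀ z, e z ∈ U i b ↔ f z.1 = z.2 := by
    have hc := (Submodule.orderIsoMapComap e.symm).isCompl (hcompl i b 0 false hib)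
    have hq : (Submodule.orderIsoMapComap e.symm) (U 0 false) = Submodule.prod ⊥ ⊤ := by
      ext z
      simp [Submodule.mem_map_equiv, Submodule.mem_prod, heq]
    rw [hq] at hc
    obtain ⟨f, hf⟩ := exists_eq_graph_of_isCompl hc
    refine ⟨f, fun z => ?_⟩
    have := SetLike.ext_iff.mp hf z
    rw [LinearMap.mem_graph_iff] at this
    rw [eq_comm, ← this]
    simp [Submodule.mem_map_equiv]
  obtain ⟨A, hA⟩ := hgraph 1 false (by simp)
  obtain ⟨B, hB⟩ := hgraph 2 true (by simp)
  obtain ⟨C, hC⟩ := hgraph 2 false (by simp)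
  have hBsurj : Function.Surjective B := by
    apply surjective_of_isCompl_graph
    have hc := (Submodule.orderIsoMapComap e.symm).isCompl (hcompl 2 true 0 true (by simp))
    have hG : (Submodule.orderIsoMapComap e.symm) (U 2 true) = LinearMap.graph B := by
      ext z
      rw [LinearMap.mem_graph_iff, eq_comm, ← hB]
      simp [Submodule.mem_map_equiv]
    have hp : (Submodule.orderIsoMapComap e.symm) (U 0 true) = Submodule.prod ⊤ ⊥ := by
      ext z
      simp [Submodule.mem_map_equiv, Submodule.mem_prod, hep]
    rwa [hG, hp] at hc
  replace h1 := @sub_smul_mem_of_crossRatio_eq _ _ _ _ _ _ _ _ _ _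
    (h1 (hcompl 1 true 1 false (by simp)) (hcompl 2 true 2 false (by simp)))
  replace h2 := @sub_smul_mem_of_crossRatio_eq _ _ _ _ _ _ _ _ _ _
    (h2 (hcompl 0 true 0 false (by simp)) (hcompl 2 true 2 false (by simp)))
  replace h3 := @sub_smul_mem_of_crossRatio_eq _ _ _ _ _ _ _ _ _ _
    (h3 (hcompl 0 true 0 false (by simp)) (hcompl 1 true 1 false (by simp)))
  have hAw (w) : (l3 - 1) • A w = l3 • w := by
    have := @h3 (e (-A w, -A w)) (e (w, A w)) ((heS _).mpr rfl) ((hA _).mpr rfl)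
      (by rw [← map_add, hep]; simp)
    rw [← map_add, ← map_smul, ← map_sub, heq] at this
    simp only [Prod.mk_add_mk, Prod.smul_mk, Prod.mk_sub_mk] at this
    linear_combination (norm := module) this
  have hCw (w) : (l2 - 1) • C w = l2 • B w := by
    obtain ⟨x, hx⟩ := hBsurj (-C w)
    have := @h2 (e (x, B x)) (e (w, C w)) ((hB _).mpr rfl) ((hC _).mpr rfl)
      (by rw [← map_add, hep]; simp [hx])
    rw [← map_add, ← map_smul, ← map_sub, heq] at this
    simp only [Prod.mk_add_mk, Prod.smul_mk, Prod.mk_sub_mk] at this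
    have := congrArg B this
    simp only [map_sub, map_smul, map_add, map_zero, hx] at this
    linear_combination (norm := module) this
  obtain ⟨w₀, hw₀⟩ := exists_ne (0 : Fin n → ℝ)
  have hl3 : l3 - 1 ≠ 0 := by
    intro h
    have := hAw w₀
    rw [h, zero_smul, sub_eq_zero.mp h, one_smul] at this
    exact hw₀ this.symm
  have hl2' : l2 ≠ 0 := by
    rintro rfl
    have hC0 := hCw w₀
    rw [zero_smul] at hC0
    have hC0 := (smul_eq_zero.mp hC0).resolve_left hl2
    have := Submodule.disjoint_def.mp (hcompl 2 false 0 true (by simp)).disjoint (e (w₀, 0))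
      ((hC _).mpr hC0) ((hep _).mpr rfl)
    rw [LinearEquiv.map_eq_zero_iff] at this
    exact hw₀ (congrArg Prod.fst this)
  have hA' : A = (l3 / (l3 - 1)) • LinearMap.id := by
    refine LinearMap.ext fun w => ?_
    rw [LinearMap.smul_apply, LinearMap.id_apply, div_eq_inv_mul, mul_smul, ← hAw,
      inv_smul_smul₀ hl3]
  have hC' : C = (l2 / (l2 - 1)) • B := by
    refine LinearMap.ext fun w => ?_
    rw [LinearMap.smul_apply, div_eq_inv_mul, mul_smul, ← hCw, inv_smul_smul₀ hl2]
  refine ⟨hl2', hl3, e, B, ?_, fun w => ?_⟩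
  · intro i b z
    fin_cases i <;> cases b <;>
      simp [modelTuple, Submodule.mem_prod, LinearMap.mem_graph_iff, hep, heq, heS, hA, hB, hC,
        hA', hC', eq_comm]
  · set p := l2 • B w - (l2 - 1) • w with hp
    set q := (l2 - 1) • (w - B w) with hq
    have hpq : p + q = B w := by rw [hp, hq]; module
    have hCq : B p + C q = B w := by
      rw [hp, hq, map_smul C, hCw]
      simp only [map_sub, map_smul]
      module
    have := @h1 (e (p, B p)) (e (q, C q)) ((hB _).mpr rfl) ((hC _).mpr rfl)
      (by rw [← map_add, heS]; simp [hpq, hCq])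
    rw [← map_add, ← map_smul, ← map_sub, hA] at this
    simp only [Prod.mk_add_mk, Prod.smul_mk, Prod.mk_sub_mk, hpq, hCq] at this
    have hAp := hAw (p - l1 • B w)
    rw [this, hp] at hAp
    simp only [map_sub, map_smul] at hAp
    linear_combination (norm := module) hAp

/-- Two good tuples whose model parameters have eigenspaces of equal dimension are equivalent. -/
lemma exists_equiv_of_modelTuple {E : Type*} [AddCommGroup E] [Module ℝ E]
    [FiniteDimensional ℝ E] {U U' : Fin 3 → Bool → Submodule ℝ V} {α d r s : ℝ} (hrs : r ≠ s)
    {e e' : (E × E) ≃ₗ[ℝ] V} {B B' : E →ₗ[ℝ] E}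
    (he : ∀ i b z, e z ∈ U i b ↔ z ∈ modelTuple α d B i b)
    (he' : ∀ i b z, e' z ∈ U' i b ↔ z ∈ modelTuple α d B' i b)
    (hB : ∀ w, B (B w) = (r + s) • B w - (r * s) • w)
    (hB' : ∀ w, B' (B' w) = (r + s) • B' w - (r * s) • w)
    (hk : finrank ℝ (LinearMap.ker (B - r • LinearMap.id)) =
      finrank ℝ (LinearMap.ker (B' - r • LinearMap.id))) :
    ∃ g : V ≃ₗ[ℝ] V, ∀ i b, U' i b = (U i b).map (g : V →ₗ[ℝ] V) := by
  obtain ⟨f, hf⟩ := exists_conj_of_finrank_ker_eq hrs hB hB' hk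
  refine ⟨e.symm.trans ((f.prodCongr f).trans e'), fun i b => ?_⟩
  ext v
  obtain ⟨z, rfl⟩ := ((f.prodCongr f).trans e').surjective v
  rw [Submodule.mem_map_equiv]
  have : (e.symm.trans ((f.prodCongr f).trans e')).symm (((f.prodCongr f).trans e') z) = e z := by
    rw [LinearEquiv.symm_apply_eq]; simp
  rw [this, he, LinearEquiv.trans_apply, he', mem_modelTuple_conj α d f hf]

end Normalization

/-- A bounded natural number-valued function on a set takes all its values on a finite subset. -/
lemma exists_finite_transversal {ι : Type*} (S : Set ι) (k : ι → ℕ) (n : ℕ)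
    (hk : ∀ u ∈ S, k u ≤ n) : ∃ F ⊆ S, F.Finite ∧ ∀ u ∈ S, ∃ v ∈ F, k v = k u := by
  have hfin : (k '' S).Finite :=
    (Set.finite_Iic n).subset (Set.image_subset_iff.mpr hk)
  obtain ⟨F, hFS, hF⟩ := Set.exists_subset_bijOn S k
  exact ⟨F, hFS, hF.finite_iff_finite.mpr hfin, fun u hu => hF.surjOn ⟨u, hu, rfl⟩⟩

theorem stmt8 (n : ℕ) (l1 l2 l3 : ℝ)
    (hlead : l3 * (1 - l2) ≠ 0) (x y : ℝ) (hxy : x ≠ y)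
    (hx : l3 * (1 - l2) * x ^ 2 + (l1 + l2 - l3 - 1) * x + (1 - l1) = 0)
    (hy : l3 * (1 - l2) * y ^ 2 + (l1 + l2 - l3 - 1) * y + (1 - l1) = 0) :
    ∃ F : Set (Fin 3 → Bool → Submodule ℝ (Fin (2 * n) → ℝ)), F.Finite ∧
      (∀ U ∈ F, GoodTuple n l1 l2 l3 U) ∧
      ∀ U, GoodTuple n l1 l2 l3 U →
        ∃ U₀ ∈ F, ∃ g : (Fin (2 * n) → ℝ) ≃ₗ[ℝ] (Fin (2 * n) → ℝ),
          ∀ i b, U i b = (U₀ i b).map (g : (Fin (2 * n) → ℝ) →ₗ[ℝ] (Fin (2 * n) → ℝ)) := by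
  rcases eq_or_ne n 0 with rfl | hn
  · have : Subsingleton (Fin (2 * 0) → ℝ) := inferInstanceAs (Subsingleton (Fin 0 → ℝ))
    refine ⟨{U | GoodTuple 0 l1 l2 l3 U}, Set.toFinite _, fun U hU => hU, fun U hU => ?_⟩
    exact ⟨U, hU, LinearEquiv.refl ℝ _, fun i b => Subsingleton.elim _ _⟩
  by_cases hne : ∃ U, GoodTuple n l1 l2 l3 U
  swap
  · exact ⟨∅, Set.finite_empty, by simp, fun U hU => (hne ⟨U, hU⟩).elim⟩
  have hl2 : l2 - 1 ≠ 0 := fun h => hlead (by rw [← neg_sub l2 1, h]; simp)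
  obtain ⟨U₁, hU₁⟩ := hne
  obtain ⟨hl2', hl3, -⟩ := hU₁.exists_modelTuple hn hl2
  obtain ⟨r, s, hrs, hsum, hprod⟩ := exists_roots_of_disc hlead hl2' hl3 hxy hx hy
  have key (U) (hU : GoodTuple n l1 l2 l3 U) := (hU.exists_modelTuple hn hl2).2.2
  choose! e B he hB using key
  have hB' (U) (hU : GoodTuple n l1 l2 l3 U) (w) :
      B U (B U w) = (r + s) • B U w - (r * s) • w := by
    apply smul_right_injective _ (mul_ne_zero hl2' hl3)
    simp only [hB U hU, smul_sub, smul_smul, hsum, hprod]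
  obtain ⟨F, hFs, hF, hcover⟩ := exists_finite_transversal {U | GoodTuple n l1 l2 l3 U}
    (fun U => finrank ℝ (LinearMap.ker (B U - r • LinearMap.id))) n
    (fun U _ => (Submodule.finrank_le _).trans_eq (by simp))
  refine ⟨F, hF, hFs, fun U hU => ?_⟩
  obtain ⟨U₀, hU₀, hk⟩ := hcover U hU
  have hG := hFs hU₀
  exact ⟨U₀, hU₀, exists_equiv_of_modelTuple hrs (he U₀ hG) (he U hU) (hB' U₀ hG) (hB' U hU) hk⟩
end
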